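/- arXiv:1508.06591 — 7 statements merged into one kernel-verified Lean document; each statement's English description precedes it below -/
import Mathlib

section
/- Let d ≥ 1 and 0 < ε < 1. There exists a constant C > 0 such that for all n ≥ 1 and all integers k with 0 ≤ k ≤ (1−ε)n: | γ((n−k)/d, n/d) / Γ((n−k)/d) − Φ( k / √((n−k)d) ) | ≤ C n^{−1/2}. -/
open MeasureTheory

/-- The lower incomplete gamma function `γ(a,x) = ∫_0^x t^(a-1) e^(-t) dt`. -/
noncomputable def lowerGamma (a x : ℝ) : ℝ :=
  ∫ t in (0 : ℝ)..x, t ^ (a - 1) * Real.exp (-t)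

/-- The standard normal distribution function. -/
noncomputable def stdNormalCDF (x : ℝ) : ℝ :=
  (Real.sqrt (2 * Real.pi))⁻¹ * ∫ s in Set.Iic x, Real.exp (-s ^ 2 / 2)

open Filter Topology Set

lemma integrable_exp_neg_sq_div_two : Integrable fun s : ℝ => Real.exp (-s ^ 2 / 2) := by
  convert integrable_exp_neg_mul_sq (b := 1 / 2) (by norm_num) using 3
  ring

lemma integral_exp_neg_sq_div_two :
    ∫ s : ℝ, Real.exp (-s ^ 2 / 2) = Real.sqrt (2 * Real.pi) := by
  rw [show 2 * Real.pi = Real.pi / (1 / 2) by ring, ← integral_gaussian]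
  congr 1 with s
  ring_nf

lemma sqrt_two_pi_pos : 0 < Real.sqrt (2 * Real.pi) :=
  Real.sqrt_pos.2 Real.two_pi_pos

lemma hasDerivAt_stdNormalCDF (w : ℝ) :
    HasDerivAt stdNormalCDF ((Real.sqrt (2 * Real.pi))⁻¹ * Real.exp (-w ^ 2 / 2)) w := by
  have h : stdNormalCDF = fun x => (Real.sqrt (2 * Real.pi))⁻¹ *
      ((∫ s in Iic (0 : ℝ), Real.exp (-s ^ 2 / 2)) + ∫ s in (0 : ℝ)..x, Real.exp (-s ^ 2 / 2)) := by
    ext x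
    rw [← intervalIntegral.integral_Iic_sub_Iic integrable_exp_neg_sq_div_two.integrableOn
      integrable_exp_neg_sq_div_two.integrableOn, add_sub_cancel, stdNormalCDF]
  rw [h]
  have hc : Continuous fun s : ℝ => Real.exp (-s ^ 2 / 2) := by fun_prop
  exact ((hc.integral_hasStrictDerivAt 0 w).hasDerivAt.const_add _).const_mul _

lemma continuous_stdNormalCDF : Continuous stdNormalCDF :=
  continuous_iff_continuousAt.2 fun w => (hasDerivAt_stdNormalCDF w).continuousAt

lemma one_sub_stdNormalCDF (w : ℝ) :
    1 - stdNormalCDF w =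
      (Real.sqrt (2 * Real.pi))⁻¹ * ∫ s in Ioi w, Real.exp (-s ^ 2 / 2) := by
  have h := intervalIntegral.integral_Iic_add_Ioi (b := w)
    integrable_exp_neg_sq_div_two.integrableOn integrable_exp_neg_sq_div_two.integrableOn
  rw [integral_exp_neg_sq_div_two] at h
  rw [stdNormalCDF, eq_sub_of_add_eq' h, mul_sub, inv_mul_cancel₀ sqrt_two_pi_pos.ne']

lemma stdNormalCDF_neg (w : ℝ) : stdNormalCDF (-w) = 1 - stdNormalCDF w := by
  rw [one_sub_stdNormalCDF, stdNormalCDF]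
  have h := integral_comp_neg_Iic (-w) fun s => Real.exp (-s ^ 2 / 2)
  simp only [neg_sq, neg_neg] at h
  rw [h]

lemma stdNormalCDF_nonneg (w : ℝ) : 0 ≤ stdNormalCDF w :=
  mul_nonneg (inv_nonneg.2 (Real.sqrt_nonneg _))
    (integral_nonneg fun _ => (Real.exp_pos _).le)

lemma stdNormalCDF_le_one (w : ℝ) : stdNormalCDF w ≤ 1 := by
  have h := stdNormalCDF_nonneg (-w)
  rw [stdNormalCDF_neg] at h
  linarith

lemma monotone_stdNormalCDF : Monotone stdNormalCDF :=
  monotone_of_hasDerivAt_nonneg hasDerivAt_stdNormalCDF fun w => by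
    show (0 : ℝ) ≤ _
    positivity

/-- The Mills ratio bound for the Gaussian tail. -/
lemma mul_one_sub_stdNormalCDF_le {w : ℝ} (hw : 0 ≤ w) :
    w * (1 - stdNormalCDF w) ≤ (Real.sqrt (2 * Real.pi))⁻¹ * Real.exp (-w ^ 2 / 2) := by
  have hlim : Tendsto (fun s : ℝ => -Real.exp (-s ^ 2 / 2)) atTop (𝓝 0) := by
    rw [← neg_zero]
    refine (Real.tendsto_exp_atBot.comp ?_).neg
    simp_rw [neg_div]
    exact tendsto_neg_atTop_atBot.comp
      ((tendsto_pow_atTop two_ne_zero).atTop_div_const two_pos)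
  have hderiv : ∀ s : ℝ, HasDerivAt (fun s : ℝ => -Real.exp (-s ^ 2 / 2))
      (s * Real.exp (-s ^ 2 / 2)) s := fun s => by
    have h := ((((hasDerivAt_id s).pow 2).neg.div_const 2).exp).neg
    refine h.congr_deriv ?_
    simp
    ring
  have hpos : ∀ s ∈ Ioi w, 0 ≤ s * Real.exp (-s ^ 2 / 2) := fun s hs =>
    mul_nonneg (hw.trans (le_of_lt hs)) (Real.exp_pos _).le
  have hint := integrableOn_Ioi_deriv_of_nonneg' (fun s _ => hderiv s) hpos hlim
  have hval := integral_Ioi_of_hasDerivAt_of_tendsto' (fun s _ => hderiv s) hint hlim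
  have hle : ∫ s in Ioi w, w * Real.exp (-s ^ 2 / 2) ≤ ∫ s in Ioi w, s * Real.exp (-s ^ 2 / 2) :=
    setIntegral_mono_on (integrable_exp_neg_sq_div_two.integrableOn.const_mul w) hint
      measurableSet_Ioi fun s hs =>
        mul_le_mul_of_nonneg_right (le_of_lt hs) (Real.exp_pos _).le
  rw [hval, integral_const_mul, zero_sub, neg_neg] at hle
  rw [one_sub_stdNormalCDF, mul_left_comm]
  exact mul_le_mul_of_nonneg_left hle (inv_nonneg.2 (Real.sqrt_nonneg _))

/-- The reciprocal of the standard normal density. -/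
noncomputable def invNormalDensity (w : ℝ) : ℝ :=
  Real.sqrt (2 * Real.pi) * Real.exp (w ^ 2 / 2)

lemma invNormalDensity_pos (w : ℝ) : 0 < invNormalDensity w :=
  mul_pos sqrt_two_pi_pos (Real.exp_pos _)

lemma invNormalDensity_neg (w : ℝ) : invNormalDensity (-w) = invNormalDensity w := by
  simp [invNormalDensity]

lemma invNormalDensity_mul_density (w : ℝ) :
    invNormalDensity w * ((Real.sqrt (2 * Real.pi))⁻¹ * Real.exp (-w ^ 2 / 2)) = 1 := by
  rw [invNormalDensity, mul_mul_mul_comm, mul_inv_cancel₀ sqrt_two_pi_pos.ne', ← Real.exp_add,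
    neg_div, add_neg_cancel, Real.exp_zero, mul_one]

lemma hasDerivAt_invNormalDensity (w : ℝ) :
    HasDerivAt invNormalDensity (w * invNormalDensity w) w := by
  have h := ((((hasDerivAt_id w).pow 2).div_const 2).exp).const_mul (Real.sqrt (2 * Real.pi))
  refine h.congr_deriv ?_
  simp [invNormalDensity]
  ring

lemma mul_invNormalDensity_mul_one_sub_le {w : ℝ} (hw : 0 ≤ w) :
    w * (invNormalDensity w * (1 - stdNormalCDF w)) ≤ 1 := by
  rw [mul_left_comm]
  refine le_of_le_of_eq ?_ (invNormalDensity_mul_density w)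
  exact mul_le_mul_of_nonneg_left (mul_one_sub_stdNormalCDF_le hw) (invNormalDensity_pos w).le

/-- The lower branch of the solution of Stein's equation for a half line satisfies the equation. -/
lemma hasDerivAt_invNormalDensity_mul_stdNormalCDF (w : ℝ) :
    HasDerivAt (fun w => invNormalDensity w * stdNormalCDF w)
      (w * (invNormalDensity w * stdNormalCDF w) + 1) w := by
  refine ((hasDerivAt_invNormalDensity w).mul (hasDerivAt_stdNormalCDF w)).congr_deriv ?_
  rw [invNormalDensity_mul_density, mul_assoc]

/-- The upper branch of the solution of Stein's equation for a half line satisfies the equation. -/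
lemma hasDerivAt_invNormalDensity_mul_one_sub (w : ℝ) :
    HasDerivAt (fun w => invNormalDensity w * (1 - stdNormalCDF w))
      (w * (invNormalDensity w * (1 - stdNormalCDF w)) - 1) w := by
  refine ((hasDerivAt_invNormalDensity w).mul
    ((hasDerivAt_stdNormalCDF w).const_sub 1)).congr_deriv ?_
  rw [mul_neg, invNormalDensity_mul_density, mul_assoc, ← sub_eq_add_neg]

lemma abs_stein_deriv_lower_le_one {w z : ℝ} (hwz : w ≤ z) :
    |(1 - stdNormalCDF z) * (w * (invNormalDensity w * stdNormalCDF w) + 1)| ≤ 1 := by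
  have hz0 := stdNormalCDF_nonneg z
  have hz1 := stdNormalCDF_le_one z
  have hw0 := stdNormalCDF_nonneg w
  have hm := monotone_stdNormalCDF hwz
  have hpos := invNormalDensity_pos w
  rcases le_total 0 w with hw | hw
  · have hM := mul_invNormalDensity_mul_one_sub_le hw
    have hX : 0 ≤ w * (invNormalDensity w * stdNormalCDF w) := by positivity
    rw [abs_of_nonneg (mul_nonneg (by linarith) (by linarith))]
    calc (1 - stdNormalCDF z) * (w * (invNormalDensity w * stdNormalCDF w) + 1)
        ≤ (1 - stdNormalCDF w) * (w * (invNormalDensity w * stdNormalCDF w) + 1) := by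
          gcongr
      _ = w * (invNormalDensity w * (1 - stdNormalCDF w)) * stdNormalCDF w
          + (1 - stdNormalCDF w) := by ring
      _ ≤ 1 * stdNormalCDF w + (1 - stdNormalCDF w) := by gcongr
      _ = 1 := by ring
  · have hM := mul_invNormalDensity_mul_one_sub_le (neg_nonneg.2 hw)
    rw [invNormalDensity_neg, stdNormalCDF_neg, sub_sub_cancel, neg_mul] at hM
    have hX : w * (invNormalDensity w * stdNormalCDF w) ≤ 0 :=
      mul_nonpos_of_nonpos_of_nonneg hw (by positivity)
    rw [abs_of_nonneg (mul_nonneg (by linarith) (by linarith))]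
    exact mul_le_one₀ (by linarith) (by linarith) (by linarith)

lemma abs_stein_deriv_upper_le_one {w : ℝ} (hw : 0 ≤ w) (z : ℝ) :
    |stdNormalCDF z * (w * (invNormalDensity w * (1 - stdNormalCDF w)) - 1)| ≤ 1 := by
  have hM := mul_invNormalDensity_mul_one_sub_le hw
  have hX : 0 ≤ w * (invNormalDensity w * (1 - stdNormalCDF w)) :=
    mul_nonneg hw (mul_nonneg (invNormalDensity_pos w).le (sub_nonneg.2 (stdNormalCDF_le_one w)))
  rw [abs_mul]
  refine mul_le_one₀ ?_ (abs_nonneg _) ?_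
  · rw [abs_of_nonneg (stdNormalCDF_nonneg z)]
    exact stdNormalCDF_le_one z
  · rw [abs_le]
    constructor <;> linarith

/-- The second moment of the standardized gamma distribution is `1`, in the form of an integral of
`(1 + W ^ 2) / 2` against the unnormalized density. -/
lemma integrableOn_gamma_mul_one_add_sq {a : ℝ} (ha : 0 < a) :
    IntegrableOn (fun t : ℝ => t ^ (a - 1) * Real.exp (-t) *
        ((1 + ((t - a) / Real.sqrt a) ^ 2) / 2)) (Ioi 0) ∧
      ∫ t in Ioi (0 : ℝ), t ^ (a - 1) * Real.exp (-t) *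
        ((1 + ((t - a) / Real.sqrt a) ^ 2) / 2) = Real.Gamma a := by
  have h0 := Real.GammaIntegral_convergent ha
  have h1 := Real.GammaIntegral_convergent (s := a + 1) (by linarith)
  have h2 := Real.GammaIntegral_convergent (s := a + 1 + 1) (by linarith)
  have e0 := Real.Gamma_eq_integral ha
  have e1 := Real.Gamma_eq_integral (s := a + 1) (by linarith)
  have e2 := Real.Gamma_eq_integral (s := a + 1 + 1) (by linarith)
  rw [Real.Gamma_add_one (by linarith), Real.Gamma_add_one ha.ne'] at e2
  rw [Real.Gamma_add_one ha.ne'] at e1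
  have hI := ((h2.const_mul (1 / (2 * a))).sub h1).add (h0.const_mul ((1 + a) / 2))
  have heq : EqOn (fun t : ℝ => 1 / (2 * a) * (Real.exp (-t) * t ^ (a + 1 + 1 - 1))
        - Real.exp (-t) * t ^ (a + 1 - 1) + (1 + a) / 2 * (Real.exp (-t) * t ^ (a - 1)))
      (fun t : ℝ => t ^ (a - 1) * Real.exp (-t) *
        ((1 + ((t - a) / Real.sqrt a) ^ 2) / 2)) (Ioi 0) := by
    intro t ht
    have r1 : t ^ (a + 1 - 1) = t ^ (a - 1) * t := by
      rw [← Real.rpow_add_one (ne_of_gt ht)]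
      ring_nf
    have r2 : t ^ (a + 1 + 1 - 1) = t ^ (a - 1) * t * t := by
      rw [← r1, ← Real.rpow_add_one (ne_of_gt ht)]
      ring_nf
    simp only [r1, r2, div_pow, Real.sq_sqrt ha.le]
    field_simp
    ring
  refine ⟨IntegrableOn.congr_fun hI heq measurableSet_Ioi, ?_⟩
  have hadd := integral_add ((h2.const_mul (1 / (2 * a))).sub h1) (h0.const_mul ((1 + a) / 2))
  have hsub := integral_sub (h2.const_mul (1 / (2 * a))) h1
  simp only [Pi.sub_apply] at hadd
  rw [← setIntegral_congr_fun measurableSet_Ioi heq, hadd, hsub, integral_const_mul, integral_const_mul, ← e0, ← e1, ← e2]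
  field_simp
  ring

/-- The derivative computation behind the Stein identity of the gamma distribution. -/
lemma hasDerivAt_gamma_mul_comp {a t c : ℝ} (ha : 0 < a) (ht : 0 < t) {f : ℝ → ℝ}
    (hf : HasDerivAt f (((t - a) / Real.sqrt a) * f ((t - a) / Real.sqrt a) + c)
      ((t - a) / Real.sqrt a)) :
    HasDerivAt (fun t => t ^ a * Real.exp (-t) * f ((t - a) / Real.sqrt a))
      (Real.sqrt a * c * (t ^ (a - 1) * Real.exp (-t)) + t ^ (a - 1) * Real.exp (-t) *
        ((t - a) / Real.sqrt a *
          (((t - a) / Real.sqrt a) * f ((t - a) / Real.sqrt a) + c))) t := by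
  have hs : 0 < Real.sqrt a := Real.sqrt_pos.2 ha
  have h1 : HasDerivAt (fun t : ℝ => (t - a) / Real.sqrt a) (1 / Real.sqrt a) t :=
    ((hasDerivAt_id t).sub_const a).div_const _
  have h2 : HasDerivAt (fun t : ℝ => t ^ a) (a * t ^ (a - 1)) t :=
    Real.hasDerivAt_rpow_const (Or.inl ht.ne')
  have h3 : HasDerivAt (fun t : ℝ => Real.exp (-t)) (Real.exp (-t) * -1) t :=
    (hasDerivAt_neg t).exp
  refine ((h2.mul h3).mul (hf.comp t h1)).congr_deriv ?_
  have hp : t ^ a = t ^ (a - 1) * t := by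
    rw [← Real.rpow_add_one ht.ne']
    ring_nf
  simp only [Function.comp, Pi.mul_apply]
  rw [hp]
  have hsq := Real.sq_sqrt ha.le
  set s := Real.sqrt a
  set w := (t - a) / s with hw
  have hwt : t = s ^ 2 + s * w := by
    rw [hw, hsq]
    field_simp
    ring
  generalize f w = y
  generalize t ^ (a - 1) = q
  generalize Real.exp (-t) = e
  rw [hwt, ← hsq]
  field_simp
  ring

/-- Berry–Esseen bound for the gamma distribution, by Stein's method. -/
theorem abs_gamma_cdf_sub_stdNormalCDF_le {a x : ℝ} (ha : 0 < a) (hx : a ≤ x) :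
    |lowerGamma a x / Real.Gamma a - stdNormalCDF ((x - a) / Real.sqrt a)|
      ≤ 1 / Real.sqrt a := by
  have hs : 0 < Real.sqrt a := Real.sqrt_pos.2 ha
  have hG : 0 < Real.Gamma a := Real.Gamma_pos_of_pos ha
  have hx0 : 0 < x := ha.trans_le hx
  set z := (x - a) / Real.sqrt a with hz
  have hz0 : 0 ≤ z := div_nonneg (sub_nonneg.2 hx) hs.le
  have hmono : ∀ {t t' : ℝ}, t ≤ t' → (t - a) / Real.sqrt a ≤ (t' - a) / Real.sqrt a :=
    fun h => by gcongr
  set P := stdNormalCDF z with hP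
  let q : ℝ → ℝ := fun t => t ^ (a - 1) * Real.exp (-t)
  let w : ℝ → ℝ := fun t => (t - a) / Real.sqrt a
  let f₁ : ℝ → ℝ := fun w => (1 - P) * (invNormalDensity w * stdNormalCDF w)
  let f₂ : ℝ → ℝ := fun w => P * (invNormalDensity w * (1 - stdNormalCDF w))
  have hf₁ : ∀ y, HasDerivAt f₁ (y * f₁ y + (1 - P)) y := fun y => by
    refine ((hasDerivAt_invNormalDensity_mul_stdNormalCDF y).const_mul (1 - P)).congr_deriv ?_
    simp only [f₁]
    ring
  have hf₂ : ∀ y, HasDerivAt f₂ (y * f₂ y + -P) y := fun y => by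
    refine ((hasDerivAt_invNormalDensity_mul_one_sub y).const_mul P).congr_deriv ?_
    simp only [f₂]
    ring
  have hf₁c : Continuous f₁ := continuous_iff_continuousAt.2 fun y => (hf₁ y).continuousAt
  have hf₂c : Continuous f₂ := continuous_iff_continuousAt.2 fun y => (hf₂ y).continuousAt
  have hwc : Continuous w := by fun_prop
  let r₁ : ℝ → ℝ := fun t => w t * (w t * f₁ (w t) + (1 - P))
  let r₂ : ℝ → ℝ := fun t => w t * (w t * f₂ (w t) + -P)
  have hr₁c : Continuous r₁ := by fun_prop
  have hr₂c : Continuous r₂ := by fun_prop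
  have hqm : Measurable q := by fun_prop
  have hq0 : ∀ t, 0 < t → 0 ≤ q t := fun t ht => by positivity
  obtain ⟨hBi, hBv⟩ := integrableOn_gamma_mul_one_add_sq ha
  have hqi : IntegrableOn q (Ioi 0) := by
    refine (Real.GammaIntegral_convergent ha).congr_fun (fun t _ => ?_) measurableSet_Ioi
    exact mul_comm _ _
  have hqv : ∫ t in Ioi (0 : ℝ), q t = Real.Gamma a := by
    rw [Real.Gamma_eq_integral ha]
    exact integral_congr_ae (Eventually.of_forall fun t => mul_comm _ _)
  have habs : ∀ y g : ℝ, |g| ≤ 1 → |y * g| ≤ (1 + y ^ 2) / 2 := fun y g hg => by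
    rw [abs_mul]
    nlinarith [abs_nonneg y, sq_abs y, sq_nonneg (|y| - 1)]
  have hb₁ : ∀ t ∈ Ioc 0 x, ‖q t * r₁ t‖ ≤ q t * ((1 + w t ^ 2) / 2) := fun t ht => by
    rw [Real.norm_eq_abs, abs_mul, abs_of_nonneg (hq0 t ht.1)]
    refine mul_le_mul_of_nonneg_left (habs _ _ ?_) (hq0 t ht.1)
    convert abs_stein_deriv_lower_le_one (hmono ht.2) using 2
    simp only [f₁, w, hP, hz]
    ring
  have hb₂ : ∀ t ∈ Ioi x, ‖q t * r₂ t‖ ≤ q t * ((1 + w t ^ 2) / 2) := fun t ht => by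
    rw [Real.norm_eq_abs, abs_mul, abs_of_nonneg (hq0 t (hx0.trans ht))]
    refine mul_le_mul_of_nonneg_left (habs _ _ ?_) (hq0 t (hx0.trans ht))
    convert abs_stein_deriv_upper_le_one (hz0.trans (hmono (le_of_lt ht))) z using 2
    simp only [f₂, w, hP]
    ring
  have hsub₁ : Ioc 0 x ⊆ Ioi 0 := Ioc_subset_Ioi_self
  have hsub₂ : Ioi x ⊆ Ioi 0 := Ioi_subset_Ioi hx0.le
  have hi₁ : IntegrableOn (fun t => q t * r₁ t) (Ioc 0 x) :=
    Integrable.mono' (hBi.mono_set hsub₁) (hqm.mul hr₁c.measurable).aestronglyMeasurable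
      ((ae_restrict_iff' measurableSet_Ioc).2 (Eventually.of_forall hb₁))
  have hi₂ : IntegrableOn (fun t => q t * r₂ t) (Ioi x) :=
    Integrable.mono' (hBi.mono_set hsub₂) (hqm.mul hr₂c.measurable).aestronglyMeasurable
      ((ae_restrict_iff' measurableSet_Ioi).2 (Eventually.of_forall hb₂))
  have hpc : ContinuousOn (fun t : ℝ => t ^ a * Real.exp (-t)) univ := by
    refine Continuous.continuousOn ?_
    exact (Real.continuous_rpow_const ha.le).mul (by fun_prop)
  rw [continuousOn_univ] at hpc
  have hid₁ : (Real.sqrt a * (1 - P)) * (∫ t in Ioc 0 x, q t) + ∫ t in Ioc 0 x, q t * r₁ t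
      = x ^ a * Real.exp (-x) * f₁ z := by
    have h := intervalIntegral.integral_eq_sub_of_hasDerivAt_of_le hx0.le
      (hpc.mul (hf₁c.comp hwc)).continuousOn
      (fun t ht => hasDerivAt_gamma_mul_comp ha ht.1 (hf₁ (w t)))
      ((intervalIntegrable_iff_integrableOn_Ioc_of_le hx0.le).2
        (((hqi.mono_set hsub₁).const_mul (Real.sqrt a * (1 - P))).add hi₁))
    rw [intervalIntegral.integral_of_le hx0.le,
      integral_add ((hqi.mono_set hsub₁).const_mul _) hi₁, integral_const_mul] at h
    rw [h]
    simp [Real.zero_rpow ha.ne', w, hz]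
  have hlim : Tendsto (fun t => t ^ a * Real.exp (-t) * f₂ (w t)) atTop (𝓝 0) := by
    have hp : Tendsto (fun t : ℝ => t ^ a * Real.exp (-t)) atTop (𝓝 0) := by
      simpa using tendsto_rpow_mul_exp_neg_mul_atTop_nhds_zero a 1 one_pos
    have hwt : Tendsto w atTop atTop :=
      (tendsto_atTop_add_const_right _ (-a) tendsto_id).atTop_div_const hs
    refine squeeze_zero_norm' ?_ hp
    filter_upwards [hwt.eventually_ge_atTop 1, eventually_gt_atTop 0] with t h1 ht
    have hM := mul_invNormalDensity_mul_one_sub_le (zero_le_one.trans h1)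
    have hN : 0 ≤ invNormalDensity (w t) * (1 - stdNormalCDF (w t)) :=
      mul_nonneg (invNormalDensity_pos _).le (sub_nonneg.2 (stdNormalCDF_le_one _))
    have hP0 : 0 ≤ P := stdNormalCDF_nonneg z
    have hP1 : P ≤ 1 := stdNormalCDF_le_one z
    have hf0 : 0 ≤ f₂ (w t) := mul_nonneg hP0 hN
    have hf1 : f₂ (w t) ≤ 1 := mul_le_one₀ hP1 hN (by nlinarith)
    have hp0 : 0 ≤ t ^ a * Real.exp (-t) := by positivity
    rw [Real.norm_of_nonneg (mul_nonneg hp0 hf0)]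
    exact mul_le_of_le_one_right hp0 hf1
  have hid₂ : (Real.sqrt a * -P) * (∫ t in Ioi x, q t) + ∫ t in Ioi x, q t * r₂ t
      = -(x ^ a * Real.exp (-x) * f₂ z) := by
    have h := integral_Ioi_of_hasDerivAt_of_tendsto
      (hpc.mul (hf₂c.comp hwc)).continuousWithinAt
      (fun t ht => hasDerivAt_gamma_mul_comp ha (hx0.trans ht) (hf₂ (w t)))
      (((hqi.mono_set hsub₂).const_mul (Real.sqrt a * -P)).add hi₂) hlim
    rw [integral_add ((hqi.mono_set hsub₂).const_mul _) hi₂, integral_const_mul] at h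
    rw [h]
    simp [w, hz]
  have hff : f₁ z = f₂ z := by
    simp only [f₁, f₂, hP]
    ring
  have hlow : lowerGamma a x = ∫ t in Ioc 0 x, q t :=
    intervalIntegral.integral_of_le hx0.le
  have hunion : Ioc 0 x ∪ Ioi x = Ioi 0 := Ioc_union_Ioi_eq_Ioi hx0.le
  have hdisj : Disjoint (Ioc 0 x) (Ioi x) := Ioc_disjoint_Ioi le_rfl
  have hsplit : (∫ t in Ioc 0 x, q t) + ∫ t in Ioi x, q t = Real.Gamma a := by
    rw [← hqv, ← hunion, setIntegral_union hdisj measurableSet_Ioi (hqi.mono_set hsub₁)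
      (hqi.mono_set hsub₂)]
  have hBsplit : (∫ t in Ioc 0 x, q t * ((1 + w t ^ 2) / 2)) +
      ∫ t in Ioi x, q t * ((1 + w t ^ 2) / 2) = Real.Gamma a := by
    rw [← hBv, ← hunion, setIntegral_union hdisj measurableSet_Ioi (hBi.mono_set hsub₁)
      (hBi.mono_set hsub₂)]
  have hn₁ := norm_integral_le_of_norm_le (hBi.mono_set hsub₁)
    ((ae_restrict_iff' measurableSet_Ioc).2 (Eventually.of_forall hb₁))
  have hn₂ := norm_integral_le_of_norm_le (hBi.mono_set hsub₂)
    ((ae_restrict_iff' measurableSet_Ioi).2 (Eventually.of_forall hb₂))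
  have hmain : Real.sqrt a * (lowerGamma a x - P * Real.Gamma a) =
      -((∫ t in Ioc 0 x, q t * r₁ t) + ∫ t in Ioi x, q t * r₂ t) := by
    rw [hff] at hid₁
    rw [hlow, ← hsplit]
    linear_combination hid₁ + hid₂
  have hbound : |Real.sqrt a * (lowerGamma a x - P * Real.Gamma a)| ≤ Real.Gamma a := by
    rw [hmain, abs_neg]
    exact (abs_add_le _ _).trans ((add_le_add hn₁ hn₂).trans hBsplit.le)
  rw [abs_mul, abs_of_pos hs] at hbound
  have hdiv : lowerGamma a x / Real.Gamma a - P =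
      (lowerGamma a x - P * Real.Gamma a) / Real.Gamma a := by
    field_simp
  rw [hdiv, abs_div, abs_of_pos hG, div_le_div_iff₀ hG hs]
  linarith

/-- Berry–Esseen type approximation for the Gamma CDF:
`|γ((n−k)/d, n/d)/Γ((n−k)/d) − Φ(k/√((n−k)d))| ≤ C n^{−1/2}` for `0 ≤ k ≤ (1−ε)n`. -/
theorem gamma_cdf_normal_approximation (d : ℝ) (hd : 1 ≤ d) (ε : ℝ) (hε0 : 0 < ε) (hε1 : ε < 1) :
    ∃ C > (0 : ℝ), ∀ n : ℕ, 1 ≤ n → ∀ k : ℕ, (k : ℝ) ≤ (1 - ε) * n →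
      |lowerGamma (((n : ℝ) - k) / d) ((n : ℝ) / d) / Real.Gamma (((n : ℝ) - k) / d) -
          stdNormalCDF ((k : ℝ) / Real.sqrt (((n : ℝ) - k) * d))|
        ≤ C / Real.sqrt n := by
  refine ⟨Real.sqrt (d / ε), Real.sqrt_pos.2 (by positivity), fun n hn k hk => ?_⟩
  have hd0 : 0 < d := by linarith
  have hn0 : (0 : ℝ) < n := by exact_mod_cast hn
  have hk0 : (0 : ℝ) ≤ k := k.cast_nonneg
  have hεn : ε * n ≤ n - k := by linarith
  have hnk : (0 : ℝ) < n - k := (mul_pos hε0 hn0).trans_le hεn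
  have ha : 0 < ((n : ℝ) - k) / d := div_pos hnk hd0
  have harg : (k : ℝ) / Real.sqrt (((n : ℝ) - k) * d) =
      ((n : ℝ) / d - ((n : ℝ) - k) / d) / Real.sqrt (((n : ℝ) - k) / d) := by
    have h : Real.sqrt (((n : ℝ) - k) * d) = d * Real.sqrt (((n : ℝ) - k) / d) := by
      rw [show ((n : ℝ) - k) * d = d ^ 2 * (((n : ℝ) - k) / d) by field_simp,
        Real.sqrt_mul (sq_nonneg d), Real.sqrt_sq hd0.le]
    rw [h, ← sub_div, sub_sub_cancel, div_div]
  rw [harg]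
  refine (abs_gamma_cdf_sub_stdNormalCDF_le ha (by gcongr; linarith)).trans ?_
  rw [← Real.sqrt_one, ← Real.sqrt_div zero_le_one, ← Real.sqrt_div (by positivity)]
  refine Real.sqrt_le_sqrt ?_
  rw [one_div_div, div_div]
  gcongr
end

section
/- Let d ≥ 1. There exist a constant C > 0 and N ∈ ℕ such that for all n ≥ N and all integers k with 0 ≤ k ≤ n−1: Γ((n−k)/d) / γ((n−k)/d, n/d) ≤ C. -/
open MeasureTheory

open Set Real in
/-- The pullback of `t ^ (a - 1) * exp (-t)` along `s ↦ a² / s` is dominated on `(0, a)` by the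
function itself. -/
lemma gamma_integrand_reflection_le {a s : ℝ} (hs : 0 < s) (hsa : s < a) :
    |-(a ^ 2 / s ^ 2)| * (exp (-(a ^ 2 / s)) * (a ^ 2 / s) ^ (a - 1)) ≤
      exp (-s) * s ^ (a - 1) := by
  have ha : 0 < a := hs.trans hsa
  have hlog : 0 ≤ log (a / s) := log_nonneg ((one_le_div hs).2 hsa.le)
  have hsinh := self_le_sinh_iff.2 hlog
  rw [sinh_log (by positivity), log_div ha.ne' hs.ne'] at hsinh
  have hmul : 2 * a * (log a - log s) ≤ a ^ 2 / s - s := by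
    calc 2 * a * (log a - log s) ≤ 2 * a * ((a / s - (a / s)⁻¹) / 2) := by gcongr
      _ = a ^ 2 / s - s := by field_simp
  rw [abs_neg, abs_of_pos (by positivity), rpow_def_of_pos (by positivity),
    rpow_def_of_pos hs, ← exp_add, ← exp_add, ← exp_log (show 0 < a ^ 2 / s ^ 2 by positivity),
    ← exp_add, exp_le_exp, log_div (by positivity) (by positivity),
    log_div (by positivity) hs.ne', log_pow, log_pow]
  push_cast
  linarith

open Set Real in
/-- The upper tail of the Gamma integral beyond the shape parameter is at most the lower part. -/
lemma setIntegral_Ioi_gamma_integrand_le {a : ℝ} (ha : 0 < a) :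
    ∫ t in Ioi a, exp (-t) * t ^ (a - 1) ≤ ∫ t in Ioo 0 a, exp (-t) * t ^ (a - 1) := by
  have hderiv : ∀ s ∈ Ioo 0 a,
      HasDerivWithinAt (fun s => a ^ 2 / s) (-(a ^ 2 / s ^ 2)) (Ioo 0 a) s := by
    intro s hs
    have h := ((hasDerivAt_inv hs.1.ne').const_mul (a ^ 2)).hasDerivWithinAt (s := Ioo 0 a)
    refine (h.congr_deriv ?_).congr (fun t _ => div_eq_mul_inv _ _) (div_eq_mul_inv _ _)
    ring
  have hinj : InjOn (fun s => a ^ 2 / s) (Ioo 0 a) := by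
    intro s hs t ht hst
    have hs' := hs.1
    have ht' := ht.1
    dsimp only at hst
    field_simp at hst
    exact hst.symm
  have himage : (fun s => a ^ 2 / s) '' Ioo 0 a = Ioi a := by
    ext t
    constructor
    · rintro ⟨s, ⟨hs, hsa⟩, rfl⟩
      rw [mem_Ioi, lt_div_iff₀ hs]
      nlinarith
    · intro ht
      have ht0 : 0 < t := ha.trans ht
      refine ⟨a ^ 2 / t, ⟨by positivity, ?_⟩, by field_simp⟩
      rw [div_lt_iff₀ ht0]
      nlinarith [mem_Ioi.1 ht]
  have hint := GammaIntegral_convergent ha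
  have htail : IntegrableOn (fun t => exp (-t) * t ^ (a - 1)) (Ioi a) :=
    hint.mono_set (Ioi_subset_Ioi ha.le)
  rw [← himage, integrableOn_image_iff_integrableOn_abs_deriv_smul measurableSet_Ioo hderiv hinj]
    at htail
  rw [← himage, integral_image_eq_integral_abs_deriv_smul measurableSet_Ioo hderiv hinj]
  exact setIntegral_mono_on htail (hint.mono_set Ioo_subset_Ioi_self) measurableSet_Ioo
    fun s hs => gamma_integrand_reflection_le hs.1 hs.2

open Set Real in
/-- The median of a Gamma distribution with unit rate is at most its mean. -/
lemma Gamma_le_two_mul_lowerGamma {a x : ℝ} (ha : 0 < a) (hax : a ≤ x) :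
    Gamma a ≤ 2 * lowerGamma a x := by
  have hint := GammaIntegral_convergent ha
  have hsplit : Gamma a =
      (∫ t in Ioc 0 a, exp (-t) * t ^ (a - 1)) + ∫ t in Ioi a, exp (-t) * t ^ (a - 1) := by
    rw [Gamma_eq_integral ha, ← Ioc_union_Ioi_eq_Ioi ha.le]
    exact setIntegral_union Ioc_disjoint_Ioi_same measurableSet_Ioi
      (hint.mono_set Ioc_subset_Ioi_self) (hint.mono_set (Ioi_subset_Ioi ha.le))
  have htail := setIntegral_Ioi_gamma_integrand_le ha
  rw [← integral_Ioc_eq_integral_Ioo] at htail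
  have hmono : ∫ t in Ioc 0 a, exp (-t) * t ^ (a - 1) ≤ lowerGamma a x := by
    rw [lowerGamma, intervalIntegral.integral_of_le (ha.le.trans hax)]
    simp_rw [mul_comm _ (exp _)]
    refine setIntegral_mono_set (hint.mono_set Ioc_subset_Ioi_self) ?_
      (Ioc_subset_Ioc_right hax).eventuallyLE
    filter_upwards [ae_restrict_mem measurableSet_Ioc] with t ht
    exact mul_nonneg (exp_pos _).le (rpow_nonneg ht.1.le _)
  linarith

/-- Uniform boundedness of `Γ((n−k)/d)/γ((n−k)/d, n/d)` over `0 ≤ k ≤ n−1`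
for all sufficiently large `n`. -/
theorem gamma_ratio_uniformly_bounded (d : ℝ) (hd : 1 ≤ d) :
    ∃ C > (0 : ℝ), ∃ N : ℕ, ∀ n ≥ N, ∀ k < n,
      Real.Gamma (((n : ℝ) - k) / d) / lowerGamma (((n : ℝ) - k) / d) ((n : ℝ) / d) ≤ C := by
  refine ⟨2, two_pos, 0, fun n _ k hk => ?_⟩
  have hd0 : 0 < d := one_pos.trans_le hd
  have hkn : (k : ℝ) < n := Nat.cast_lt.2 hk
  have ha : 0 < ((n : ℝ) - k) / d := div_pos (sub_pos.2 hkn) hd0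
  have hax : ((n : ℝ) - k) / d ≤ n / d := by
    gcongr
    exact sub_le_self _ k.cast_nonneg
  have hle := Gamma_le_two_mul_lowerGamma ha hax
  have hpos := Real.Gamma_pos_of_pos ha
  exact (div_le_iff₀ (by linarith)).2 hle
end

section
/- Let d ≥ 1 and fix t ≤ 0. Then lim_{n→∞} Σ_{k=0}^{n−1} ( t + n/d )^{(n−k)/d − 1} e^{−(t + n/d)} / γ((n−k)/d, n/d) = d log 2, and the convergence is uniform for t in compact subsets of (−∞, 0]. -/
open MeasureTheory Filter Finset

lemma sum_range_eq_integral_floor (n : ℕ) (f : ℕ → ℝ) {c : ℝ} (hc : 0 < c) :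
    ∑ k ∈ range n, f k =
      ∫ s in Set.Ioi (0 : ℝ), c * (if ⌊c * s⌋₊ < n then f ⌊c * s⌋₊ else 0) := by
  have hstep : ∀ k : ℕ, Set.EqOn (fun u : ℝ => if ⌊u⌋₊ < n then f ⌊u⌋₊ else 0)
      (fun _ => if k < n then f k else 0) (Set.Ico (k : ℝ) ((k + 1 : ℕ) : ℝ)) := by
    intro k u hu
    have : ⌊u⌋₊ = k := Nat.floor_eq_on_Ico k u (by simpa using hu)
    simp [this]
  have hint : ∀ k < n, IntervalIntegrable (fun u : ℝ => if ⌊u⌋₊ < n then f ⌊u⌋₊ else 0) volume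
      ((fun i : ℕ => (i : ℝ)) k) ((fun i : ℕ => (i : ℝ)) (k + 1)) := by
    intro k _
    rw [intervalIntegrable_iff_integrableOn_Ico_of_le (by simp)]
    exact IntegrableOn.congr_fun (by simp) (hstep k).symm measurableSet_Ico
  have hsum := intervalIntegral.sum_integral_adjacent_intervals hint
  have hval : ∀ k ∈ range n, ∫ u in ((fun i : ℕ => (i : ℝ)) k)..((fun i : ℕ => (i : ℝ)) (k + 1)),
      (if ⌊u⌋₊ < n then f ⌊u⌋₊ else 0) = f k := by
    intro k hk
    rw [intervalIntegral.integral_of_le (by simp), ← integral_Ico_eq_integral_Ioc,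
      setIntegral_congr_fun measurableSet_Ico (hstep k)]
    simp [Finset.mem_range.mp hk]
  rw [Finset.sum_congr rfl hval] at hsum
  rw [hsum, integral_const_mul,
    integral_comp_mul_left_Ioi (fun u : ℝ => if ⌊u⌋₊ < n then f ⌊u⌋₊ else 0) 0 hc, smul_eq_mul,
    mul_inv_cancel_left₀ hc.ne', mul_zero, intervalIntegral.integral_of_le (by simp)]
  simp only [Nat.cast_zero]
  rw [← integral_Ico_eq_integral_Ioc, ← integral_Ici_eq_integral_Ioi]
  symm
  refine setIntegral_eq_of_subset_of_forall_sdiff_eq_zero measurableSet_Ici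
    Set.Ico_subset_Ici_self fun u hu => ?_
  have h1 : (n : ℝ) ≤ u := by
    by_contra! h
    exact hu.2 ⟨hu.1, h⟩
  rw [if_neg (Nat.le_floor h1).not_gt]

lemma log_one_sub_le {y : ℝ} (h0 : 0 ≤ y) (h1 : y < 1) : Real.log (1 - y) ≤ -y - y ^ 2 / 2 := by
  have h := sum_le_hasSum (range 2) (fun i _ => by positivity)
    (Real.hasSum_pow_div_log_of_abs_lt_one (abs_lt.mpr ⟨by linarith, h1⟩))
  norm_num [Finset.sum_range_succ] at h
  linarith

lemma abs_add_log_one_sub_le {y : ℝ} (h0 : 0 ≤ y) (h1 : y ≤ 1 / 2) :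
    |y + Real.log (1 - y)| ≤ 2 * y ^ 2 := by
  have h := Real.abs_log_sub_add_sum_range_le (x := y) (abs_lt.mpr ⟨by linarith, by linarith⟩) 1
  norm_num [abs_of_nonneg h0] at h
  refine h.trans ?_
  rw [div_le_iff₀ (by linarith)]
  nlinarith [mul_nonneg (sq_nonneg y) (by linarith : (0 : ℝ) ≤ 1 / 2 - y)]

/-- The logarithm of the integrand of `γ(r² - σ r, r²)` after the substitution `u = r² - r v`,
up to normalization. -/
noncomputable def edgeExponent (r σ v : ℝ) : ℝ :=
  (r ^ 2 - σ * r - 1) * Real.log (1 - v / r) + v * r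

/-- The normalized lower incomplete gamma function near the transition point. -/
noncomputable def edgeIntegral (r σ : ℝ) : ℝ :=
  ∫ v in Set.Ioo 0 r, Real.exp (edgeExponent r σ v)

lemma exp_edgeExponent {r v : ℝ} (σ : ℝ) (hr : 0 < r) (hv : v < r) :
    Real.exp (edgeExponent r σ v) =
      (1 - v / r) ^ (r ^ 2 - σ * r - 1) * Real.exp (v * r) := by
  have : 0 < 1 - v / r := by rw [sub_pos, div_lt_one hr]; exact hv
  rw [edgeExponent, Real.exp_add, Real.rpow_def_of_pos this, mul_comm (Real.log _)]

lemma lowerGamma_eq_edgeIntegral {r : ℝ} (σ : ℝ) (hr : 0 < r) :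
    lowerGamma (r ^ 2 - σ * r) (r ^ 2) =
      (r ^ 2) ^ (r ^ 2 - σ * r - 1) * Real.exp (-r ^ 2) * r * edgeIntegral r σ := by
  have h := intervalIntegral.integral_comp_sub_mul (a := 0) (b := r)
    (fun u : ℝ => u ^ (r ^ 2 - σ * r - 1) * Real.exp (-u)) hr.ne' (r ^ 2)
  rw [mul_zero, sub_zero, show r ^ 2 - r * r = 0 by ring, smul_eq_mul,
    intervalIntegral.integral_of_le hr.le, integral_Ioc_eq_integral_Ioo] at h
  rw [lowerGamma, eq_comm, edgeIntegral, mul_right_comm, ← eq_div_iff hr.ne', div_eq_inv_mul, ← h,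
    ← integral_const_mul]
  refine setIntegral_congr_fun measurableSet_Ioo fun v hv => ?_
  have h1 : 0 < 1 - v / r := by rw [sub_pos, div_lt_one hr]; exact hv.2
  rw [exp_edgeExponent σ hr hv.2, show r ^ 2 - r * v = r ^ 2 * (1 - v / r) by field_simp,
    Real.mul_rpow (by positivity) h1.le,
    show -(r ^ 2 * (1 - v / r)) = -r ^ 2 + v * r by field_simp; ring, Real.exp_add]
  ring

lemma integrableOn_exp_edgeExponent {r σ : ℝ} (hr : 0 < r) (h : 0 < r ^ 2 - σ * r) :
    IntegrableOn (fun v => Real.exp (edgeExponent r σ v)) (Set.Ioo 0 r) := by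
  have h1 := (intervalIntegral.intervalIntegrable_rpow' (a := 0) (b := r)
    (by linarith : -1 < r ^ 2 - σ * r - 1)).comp_sub_left r
  have h2 := (h1.symm.div_const (r ^ (r ^ 2 - σ * r - 1))).mul_continuousOn
    (g := fun v => Real.exp (v * r)) (by fun_prop)
  rw [sub_self, sub_zero, intervalIntegrable_iff_integrableOn_Ioo_of_le hr.le] at h2
  refine h2.congr_fun (fun v hv => ?_) measurableSet_Ioo
  simp only []
  rw [exp_edgeExponent σ hr hv.2, ← Real.div_rpow (sub_nonneg.mpr hv.2.le) hr.le, sub_div,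
    div_self hr.ne']

lemma neg_two_mul_sq_add_mul_le_edgeExponent {r σ v : ℝ} (hr : 2 ≤ r) (hσ : 0 ≤ σ) (h0 : 0 ≤ v)
    (h1 : v ≤ 1) : -2 * v ^ 2 + σ * v ≤ edgeExponent r σ v := by
  have hr0 : 0 < r := by linarith
  have hy : v / r ≤ 1 / 2 := by rw [div_le_iff₀ hr0]; linarith
  have hy0 : 0 ≤ v / r := by positivity
  have hA := mul_le_mul_of_nonneg_left (abs_le.mp (abs_add_log_one_sub_le hy0 hy)).1 (sq_nonneg r)
  have hB : Real.log (1 - v / r) ≤ -(v / r) := by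
    have := Real.log_le_sub_one_of_pos (by linarith : 0 < 1 - v / r)
    linarith
  have hC := mul_le_mul_of_nonneg_left hB (by positivity : 0 ≤ σ * r + 1)
  have e1 : r ^ 2 * -(2 * (v / r) ^ 2) = -2 * v ^ 2 := by field_simp
  have e3 : r ^ 2 * (v / r + Real.log (1 - v / r)) = v * r + r ^ 2 * Real.log (1 - v / r) := by
    field_simp
  have e2 : (σ * r + 1) * -(v / r) = - (σ * v) - v / r := by field_simp; ring
  rw [edgeExponent]
  linarith

lemma exp_le_edgeIntegral {r σ : ℝ} (hr : 2 ≤ r) (hσ : 0 ≤ σ) (h : 0 < r ^ 2 - σ * r) :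
    Real.exp (-2 + σ / 2) / 2 ≤ edgeIntegral r σ := by
  have hint := integrableOn_exp_edgeExponent (by linarith) h
  have hsub : Set.Icc (1 / 2 : ℝ) 1 ⊆ Set.Ioo 0 r := fun v hv =>
    ⟨by linarith [hv.1], by linarith [hv.2]⟩
  calc Real.exp (-2 + σ / 2) / 2 = ∫ _ in Set.Icc (1 / 2 : ℝ) 1, Real.exp (-2 + σ / 2) := by
        simp; norm_num; ring
    _ ≤ ∫ v in Set.Icc (1 / 2 : ℝ) 1, Real.exp (edgeExponent r σ v) := by
        refine setIntegral_mono_on (by simp) (hint.mono_set hsub) measurableSet_Icc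
          fun v hv => Real.exp_le_exp.mpr ?_
        refine le_trans ?_ (neg_two_mul_sq_add_mul_le_edgeExponent hr hσ (by linarith [hv.1]) hv.2)
        nlinarith [hv.1, hv.2]
    _ ≤ edgeIntegral r σ := setIntegral_mono_set hint
        (Eventually.of_forall fun v => (Real.exp_pos _).le) hsub.eventuallyLE

lemma edgeExponent_le {r σ v : ℝ} (hr : 1 ≤ r) (hA : r ^ 2 / 2 ≤ r ^ 2 - σ * r - 1) (h0 : 0 ≤ v)
    (h1 : v < r) : edgeExponent r σ v ≤ (σ + 1) * v - v ^ 2 / 4 := by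
  have hr0 : 0 < r := by linarith
  have hy0 : 0 ≤ v / r := by positivity
  have hl := log_one_sub_le hy0 ((div_lt_one hr0).mpr h1)
  have hv : v / r ≤ v := div_le_self h0 hr
  have hm := mul_le_mul_of_nonneg_left hl (le_trans (by positivity) hA)
  have hm2 := mul_le_mul_of_nonneg_right hA (by positivity : 0 ≤ (v / r) ^ 2 / 2)
  have e1 : r ^ 2 / 2 * ((v / r) ^ 2 / 2) = v ^ 2 / 4 := by field_simp; ring
  have e2 : (r ^ 2 - σ * r - 1) * (v / r) = v * r - σ * v - v / r := by field_simp
  rw [edgeExponent]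
  nlinarith

lemma tendsto_sq_mul_add_log_one_sub_div (v : ℝ) :
    Tendsto (fun r : ℝ => r ^ 2 * (v / r + Real.log (1 - v / r))) atTop (nhds (-(v ^ 2 / 2))) := by
  rw [tendsto_iff_norm_sub_tendsto_zero]
  have hlim : Tendsto (fun r : ℝ => |v| ^ 3 * (r - |v|)⁻¹) atTop (nhds 0) := by
    simpa [← sub_eq_add_neg] using (tendsto_inv_atTop_zero.comp
      (tendsto_atTop_add_const_right _ (-|v|) tendsto_id)).const_mul (|v| ^ 3)
  refine squeeze_zero' (Eventually.of_forall fun _ => norm_nonneg _) ?_ hlim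
  filter_upwards [eventually_gt_atTop |v|] with r hr
  have hr0 : 0 < r := (abs_nonneg v).trans_lt hr
  have habs : |v / r| = |v| / r := by rw [abs_div, abs_of_pos hr0]
  have h := Real.abs_log_sub_add_sum_range_le (x := v / r)
    (by rwa [habs, div_lt_one hr0]) 2
  norm_num [Finset.sum_range_succ] at h
  rw [habs] at h
  have h2 := mul_le_mul_of_nonneg_left h (sq_nonneg r)
  have hsub : 0 < r - |v| := sub_pos.mpr hr
  have e1 : r ^ 2 * ((|v| / r) ^ 3 / (1 - |v| / r)) = |v| ^ 3 * (r - |v|)⁻¹ := by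
    have : 1 - |v| / r = (r - |v|) / r := by field_simp
    rw [this]
    field_simp
  have e2 : r ^ 2 * (v / r + Real.log (1 - v / r)) - -(v ^ 2 / 2) =
      r ^ 2 * (v / r + (v / r) ^ 2 / 2 + Real.log (1 - v / r)) := by
    field_simp
    ring
  rw [Real.norm_eq_abs, e2, abs_mul, abs_of_nonneg (sq_nonneg r)]
  exact h2.trans_eq e1

section Limits

variable {ι : Type*} {l : Filter ι} {r σ : ι → ℝ} {s : ℝ}

lemma tendsto_edgeExponent (hr : Tendsto r l atTop) (hσ : Tendsto σ l (nhds s)) (v : ℝ) :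
    Tendsto (fun q => edgeExponent (r q) (σ q) v) l (nhds (s * v - v ^ 2 / 2)) := by
  have h1 := (tendsto_sq_mul_add_log_one_sub_div v).comp hr
  have h2 := (Real.tendsto_mul_log_one_add_div_atTop (-v)).comp hr
  have h3 := tendsto_inv_atTop_zero.comp hr
  have h4 := h1.sub ((hσ.add h3).mul h2)
  rw [show -(v ^ 2 / 2) - (s + 0) * -v = s * v - v ^ 2 / 2 by ring] at h4
  refine h4.congr' ?_
  filter_upwards [hr.eventually_gt_atTop 0] with q hq
  simp only [Function.comp_apply, edgeExponent, neg_div, ← sub_eq_add_neg]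
  field_simp
  ring

lemma integrable_exp_mul_sub_sq (s : ℝ) {b : ℝ} (hb : 0 < b) :
    Integrable fun v : ℝ => Real.exp (s * v - b * v ^ 2) := by
  have h := ((integrable_exp_neg_mul_sq hb).comp_sub_right (s / (2 * b))).const_mul
    (Real.exp (s ^ 2 / (4 * b)))
  refine h.congr (Eventually.of_forall fun v => ?_)
  simp only [← Real.exp_add]
  congr 1
  field_simp
  ring

lemma tendsto_edgeIntegral [l.IsCountablyGenerated] (hr : Tendsto r l atTop)
    (hσ : Tendsto σ l (nhds s)) :
    Tendsto (fun q => edgeIntegral (r q) (σ q)) l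
      (nhds (∫ v in Set.Ioi (0 : ℝ), Real.exp (s * v - v ^ 2 / 2))) := by
  have hind : ∀ q, edgeIntegral (r q) (σ q) = ∫ v in Set.Ioi (0 : ℝ),
      (Set.Iio (r q)).indicator (fun v => Real.exp (edgeExponent (r q) (σ q) v)) v := fun q => by
    rw [setIntegral_indicator measurableSet_Iio, Set.Ioi_inter_Iio, edgeIntegral]
  simp_rw [hind]
  refine tendsto_integral_filter_of_dominated_convergence
    (fun v => Real.exp ((s + 2) * v - 1 / 4 * v ^ 2)) ?_ ?_
    (integrable_exp_mul_sub_sq _ (by norm_num)).integrableOn ?_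
  · refine Eventually.of_forall fun q => Measurable.aestronglyMeasurable ?_
    unfold edgeExponent
    exact Measurable.indicator (by fun_prop) measurableSet_Iio
  · filter_upwards [hr.eventually_ge_atTop 1, hr.eventually_ge_atTop (2 * (|s| + 2)),
      hσ.eventually_le_const (lt_add_one s)] with q h1 h2 h3
    refine (ae_restrict_iff' measurableSet_Ioi).mpr (Eventually.of_forall fun v hv => ?_)
    have hv : 0 < v := hv
    by_cases hvr : v < r q
    · rw [Set.indicator_of_mem (Set.mem_Iio.mpr hvr), Real.norm_of_nonneg (Real.exp_pos _).le]
      refine Real.exp_le_exp.mpr ((edgeExponent_le h1 ?_ hv.le hvr).trans ?_)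
      · nlinarith [le_abs_self s]
      · nlinarith
    · rw [Set.indicator_of_notMem (by simpa using hvr), norm_zero]
      positivity
  · refine Eventually.of_forall fun v => ?_
    refine ((Real.continuous_exp.tendsto _).comp (tendsto_edgeExponent hr hσ v)).congr' ?_
    filter_upwards [hr.eventually_gt_atTop v] with q hq
    rw [Set.indicator_of_mem (Set.mem_Iio.mpr hq), Function.comp_apply]

lemma tendsto_one_add_div_sq_rpow_mul_exp_neg {t : ι → ℝ} {M : ℝ} (hr : Tendsto r l atTop)
    (hσ : Tendsto σ l (nhds s)) (ht : ∀ᶠ q in l, t q ∈ Set.Icc (-M) 0) :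
    Tendsto (fun q => (1 + t q / r q ^ 2) ^ (r q ^ 2 - σ q * r q - 1) * Real.exp (-t q)) l
      (nhds 1) := by
  have hinv := tendsto_inv_atTop_zero.comp hr
  have hbound : Tendsto (fun q => 2 * M ^ 2 * (r q)⁻¹ ^ 2 +
      2 * M * (|σ q| * (r q)⁻¹ + (r q)⁻¹ ^ 2)) l (nhds 0) := by
    simpa using ((hinv.pow 2).const_mul (2 * M ^ 2)).add
      (((hσ.abs.mul hinv).add (hinv.pow 2)).const_mul (2 * M))
  have hexp : Tendsto (fun q => (r q ^ 2 - σ q * r q - 1) * Real.log (1 + t q / r q ^ 2) - t q) l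
      (nhds 0) := by
    refine squeeze_zero_norm' ?_ hbound
    filter_upwards [hr.eventually_ge_atTop 1, hr.eventually_ge_atTop (2 * M), ht]
      with q h1 h2 h3
    obtain ⟨y, hy⟩ : ∃ y, y = -t q / r q ^ 2 := ⟨_, rfl⟩
    have hr0 : 0 < r q := by linarith
    have hy0 : 0 ≤ y := by rw [hy]; exact div_nonneg (by linarith [h3.2]) (by positivity)
    have hyM : y ≤ M * (r q)⁻¹ ^ 2 := by
      rw [hy, div_eq_mul_inv, inv_pow]
      exact mul_le_mul_of_nonneg_right (by linarith [h3.1]) (by positivity)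
    have hy2 : y ≤ 1 / 2 := by
      rw [hy, div_le_iff₀ (by positivity)]
      nlinarith [h3.1]
    have hM : 0 ≤ M := by linarith [h3.1, h3.2]
    have hlog := abs_add_log_one_sub_le hy0 hy2
    have hlog2 : |Real.log (1 - y)| ≤ 2 * y := by
      rw [abs_le] at hlog ⊢
      constructor <;> nlinarith
    have e : (r q ^ 2 - σ q * r q - 1) * Real.log (1 + t q / r q ^ 2) - t q =
        r q ^ 2 * (y + Real.log (1 - y)) - (σ q * r q + 1) * Real.log (1 - y) := by
      have : 1 + t q / r q ^ 2 = 1 - y := by rw [hy]; ring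
      rw [this]
      have : t q = - (r q ^ 2 * y) := by rw [hy]; field_simp
      rw [this]
      ring
    rw [e, Real.norm_eq_abs]
    have hA : |r q ^ 2 * (y + Real.log (1 - y))| ≤ 2 * M ^ 2 * (r q)⁻¹ ^ 2 := by
      rw [abs_mul, abs_of_nonneg (sq_nonneg (r q))]
      calc r q ^ 2 * |y + Real.log (1 - y)| ≤ r q ^ 2 * (2 * (M * (r q)⁻¹ ^ 2) ^ 2) := by
            gcongr
            exact hlog.trans (by gcongr)
        _ = _ := by field_simp
    have hB : |(σ q * r q + 1) * Real.log (1 - y)| ≤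
        2 * M * (|σ q| * (r q)⁻¹ + (r q)⁻¹ ^ 2) := by
      have hs : |σ q * r q + 1| ≤ |σ q| * r q + 1 := by
        refine (abs_add_le _ _).trans_eq ?_
        rw [abs_mul, abs_of_pos hr0, abs_one]
      rw [abs_mul]
      calc |σ q * r q + 1| * |Real.log (1 - y)|
          ≤ (|σ q| * r q + 1) * (2 * (M * (r q)⁻¹ ^ 2)) := by
            gcongr
            exact hlog2.trans (by gcongr)
        _ = _ := by field_simp
    exact (abs_sub _ _).trans (add_le_add hA hB)
  have h := (Real.continuous_exp.tendsto _).comp hexp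
  rw [Real.exp_zero] at h
  refine h.congr' ?_
  filter_upwards [hr.eventually_ge_atTop 1, hr.eventually_gt_atTop M, ht] with q h1 h2 h3
  have : 0 < 1 + t q / r q ^ 2 := by
    have : -1 < t q / r q ^ 2 := by
      rw [lt_div_iff₀ (by positivity)]
      nlinarith [h3.1]
    linarith
  rw [Function.comp_apply, Real.rpow_def_of_pos this, ← Real.exp_add]
  congr 1
  ring

end Limits

lemma integral_exp_mul_sub_sq_pos (s : ℝ) :
    0 < ∫ v in Set.Ioi (0 : ℝ), Real.exp (s * v - v ^ 2 / 2) := by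
  have h := (integrable_exp_mul_sub_sq s (by norm_num : (0 : ℝ) < 1 / 2)).integrableOn
    (s := Set.Ioi 0)
  have h' : IntegrableOn (fun v : ℝ => Real.exp (s * v - v ^ 2 / 2)) (Set.Ioi 0) :=
    h.congr_fun (fun v _ => by ring_nf) measurableSet_Ioi
  rw [integral_pos_iff_support_of_nonneg (fun v => (Real.exp_pos _).le) h']
  simp [Function.support, Real.exp_ne_zero]

lemma integral_Ioi_exp_mul_sub_sq (s : ℝ) :
    ∫ v in Set.Ioi (0 : ℝ), Real.exp (s * v - v ^ 2 / 2) =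
      Real.exp (s ^ 2 / 2) * ∫ w in Set.Iic s, Real.exp (-(1 / 2) * w ^ 2) := by
  have h := (Measure.measurePreserving_sub_left volume s).setIntegral_preimage_emb
    (MeasurableEquiv.subLeft s).measurableEmbedding
    (fun w : ℝ => Real.exp (-(1 / 2) * w ^ 2)) (Set.Iic s)
  rw [Set.preimage_const_sub_Iic, sub_self, integral_Ici_eq_integral_Ioi] at h
  rw [← h, ← integral_const_mul]
  refine setIntegral_congr_fun measurableSet_Ioi fun v _ => ?_
  simp only [← Real.exp_add]
  ring_nf

lemma integral_Ioi_inv_integral_exp_mul_sub_sq :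
    ∫ s in Set.Ioi (0 : ℝ), (∫ v in Set.Ioi (0 : ℝ), Real.exp (s * v - v ^ 2 / 2))⁻¹ =
      Real.log 2 := by
  have hint : Integrable fun w : ℝ => Real.exp (-(1 / 2) * w ^ 2) :=
    integrable_exp_neg_mul_sq (by norm_num)
  obtain ⟨Ψ, hΨ⟩ : ∃ Ψ : ℝ → ℝ, Ψ = fun s => ∫ w in Set.Iic s, Real.exp (-(1 / 2) * w ^ 2) :=
    ⟨_, rfl⟩
  have hJ : ∀ s, ∫ v in Set.Ioi (0 : ℝ), Real.exp (s * v - v ^ 2 / 2) =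
      Real.exp (s ^ 2 / 2) * Ψ s := fun s => by rw [hΨ, integral_Ioi_exp_mul_sub_sq]
  have hpos : ∀ s, 0 < Ψ s := fun s => by
    have := integral_exp_mul_sub_sq_pos s
    rw [hJ] at this
    exact pos_of_mul_pos_right this (Real.exp_pos _).le
  have hΨ0 : Ψ 0 = √(2 * Real.pi) / 2 := by
    have h := integral_comp_neg_Ioi 0 (fun w : ℝ => Real.exp (-(1 / 2) * w ^ 2))
    simp only [neg_sq, neg_zero] at h
    rw [hΨ]
    simp only []
    rw [← h, integral_gaussian_Ioi]
    congr 2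
    ring
  have hEq : Ψ = fun s => Ψ 0 + ∫ w in (0 : ℝ)..s, Real.exp (-(1 / 2) * w ^ 2) := by
    funext s
    rw [hΨ, ← intervalIntegral.integral_Iic_sub_Iic hint.integrableOn hint.integrableOn]
    ring
  have hlim : Tendsto Ψ atTop (nhds √(2 * Real.pi)) := by
    have h := (intervalIntegral_tendsto_integral_Ioi 0 hint.integrableOn tendsto_id).const_add (Ψ 0)
    rw [integral_gaussian_Ioi, hΨ0, show Real.pi / (1 / 2) = 2 * Real.pi by ring, add_halves] at h
    rw [hEq, hΨ0]
    exact h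
  have hderiv : ∀ s, HasDerivAt Ψ (Real.exp (-(1 / 2) * s ^ 2)) s := fun s => by
    have hcont : Continuous fun w : ℝ => Real.exp (-(1 / 2) * w ^ 2) := by fun_prop
    rw [hEq]
    exact (hcont.integral_hasStrictDerivAt 0 s).hasDerivAt.const_add _
  have hmain := integral_Ioi_of_hasDerivAt_of_nonneg' (a := 0)
    (g := fun s => Real.log (Ψ s)) (g' := fun s => Real.exp (-(1 / 2) * s ^ 2) / Ψ s)
    (fun s _ => (hderiv s).log (hpos s).ne')
    (fun s _ => div_nonneg (Real.exp_pos _).le (hpos s).le)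
    (((Real.continuousAt_log (by positivity)).tendsto).comp hlim)
  rw [hΨ0, Real.log_div (by positivity) (by norm_num), sub_sub_cancel] at hmain
  rw [← hmain]
  refine setIntegral_congr_fun measurableSet_Ioi fun s _ => ?_
  simp only [hJ]
  rw [mul_inv, ← Real.exp_neg, div_eq_mul_inv]
  ring_nf

lemma div_lowerGamma_eq_div_edgeIntegral {r t : ℝ} (σ : ℝ) (hr : 0 < r) (ht : -r ^ 2 < t) :
    (t + r ^ 2) ^ (r ^ 2 - σ * r - 1) * Real.exp (-(t + r ^ 2)) /
        lowerGamma (r ^ 2 - σ * r) (r ^ 2) =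
      (1 + t / r ^ 2) ^ (r ^ 2 - σ * r - 1) * Real.exp (-t) / (r * edgeIntegral r σ) := by
  have h1 : 0 < 1 + t / r ^ 2 := by
    have : -1 < t / r ^ 2 := by
      rw [lt_div_iff₀ (by positivity)]
      linarith
    linarith
  have hpow : (r ^ 2) ^ (r ^ 2 - σ * r - 1) ≠ 0 := (Real.rpow_pos_of_pos (by positivity) _).ne'
  rw [lowerGamma_eq_edgeIntegral σ hr, show t + r ^ 2 = r ^ 2 * (1 + t / r ^ 2) by field_simp; ring,
    Real.mul_rpow (by positivity) h1.le,
    show -(r ^ 2 * (1 + t / r ^ 2)) = -r ^ 2 + -t by field_simp; ring, Real.exp_add]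
  have hexp := (Real.exp_pos (-r ^ 2)).ne'
  rw [show ∀ a b c e f g : ℝ,
    a * b * (c * e) / (a * c * f * g) = (a * c) * (b * e) / ((a * c) * (f * g))
    by intros; ring_nf]
  exact mul_div_mul_left _ _ (mul_ne_zero hpow hexp)

lemma rpow_le_two {b p : ℝ} (h0 : 1 / 2 ≤ b) (h1 : b ≤ 1) (hp : -1 ≤ p) : b ^ p ≤ 2 :=
  calc b ^ p ≤ b ^ (-1 : ℝ) := Real.rpow_le_rpow_of_exponent_ge (by linarith) h1 hp
    _ ≤ 2 := by
      rw [Real.rpow_neg_one]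
      exact inv_le_of_inv_le₀ (by norm_num) (by linarith)

/-- The rescaled one-point intensity of the hard edge power ensemble converges:
`Σ_{k=0}^{n−1} (t + n/d)^{(n−k)/d − 1} e^{−(t+n/d)} / γ((n−k)/d, n/d) → d log 2`,
uniformly for `t` in compact subsets of `(−∞, 0]`. -/
theorem hard_edge_intensity_limit (d : ℝ) (hd : 1 ≤ d)
    (K : Set ℝ) (hK : IsCompact K) (hK' : K ⊆ Set.Iic 0) :
    TendstoUniformlyOn
      (fun (n : ℕ) (t : ℝ) =>
        ∑ k ∈ Finset.range n,
          (t + (n : ℝ) / d) ^ (((n : ℝ) - k) / d - 1) * Real.exp (-(t + (n : ℝ) / d)) /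
            lowerGamma (((n : ℝ) - k) / d) ((n : ℝ) / d))
      (fun _ => d * Real.log 2) atTop K := by
  have hd0 : 0 < d := by linarith
  obtain ⟨M, hM⟩ := hK.isBounded.subset_closedBall 0
  have hKM : ∀ t ∈ K, t ∈ Set.Icc (-M) 0 := fun t ht => by
    have h := hM ht
    rw [mem_closedBall_zero_iff, Real.norm_eq_abs] at h
    exact ⟨(abs_le.mp h).1, hK' ht⟩
  rw [← tendsto_prod_principal_iff]
  let r : ℕ × ℝ → ℝ := fun q => √(q.1 / d)
  let σ : ℝ → ℕ × ℝ → ℝ := fun s q => ⌊d * r q * s⌋₊ / (d * r q)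
  let f : ℕ × ℝ → ℕ → ℝ := fun q k =>
    (q.2 + (q.1 : ℝ) / d) ^ (((q.1 : ℝ) - k) / d - 1) * Real.exp (-(q.2 + (q.1 : ℝ) / d)) /
      lowerGamma (((q.1 : ℝ) - k) / d) ((q.1 : ℝ) / d)
  have hr : Tendsto r (atTop ×ˢ 𝓟 K) atTop := Real.tendsto_sqrt_atTop.comp
    ((tendsto_natCast_atTop_atTop.comp tendsto_fst).atTop_div_const hd0)
  have hmem : ∀ᶠ q : ℕ × ℝ in atTop ×ˢ 𝓟 K, q.2 ∈ Set.Icc (-M) 0 :=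
    tendsto_snd.eventually (eventually_principal.mpr hKM)
  have hrsq : ∀ q, r q ^ 2 = q.1 / d := fun q => Real.sq_sqrt (by positivity)
  have hσ : ∀ s, 0 < s → Tendsto (σ s) (atTop ×ˢ 𝓟 K) (nhds s) := fun s hs => by
    refine ((tendsto_nat_floor_mul_div_atTop hs.le).comp (hr.const_mul_atTop hd0)).congr
      fun q => ?_
    simp only [Function.comp_apply, σ, mul_comm]
  have hindex : ∀ q s, 0 < r q →
      ((q.1 : ℝ) - ⌊d * r q * s⌋₊) / d = r q ^ 2 - σ s q * r q := fun q s hq => by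
    rw [hrsq]
    simp only [σ]
    field_simp
  have hsummand : ∀ q s, 0 < r q → -r q ^ 2 < q.2 → d * r q * f q ⌊d * r q * s⌋₊ =
      d * ((1 + q.2 / r q ^ 2) ^ (r q ^ 2 - σ s q * r q - 1) * Real.exp (-q.2) *
        (edgeIntegral (r q) (σ s q))⁻¹) := fun q s h1 h2 => by
    simp only [f]
    rw [hindex q s h1, ← hrsq, div_lowerGamma_eq_div_edgeIntegral _ h1 h2]
    field_simp
  have hlt : ∀ᶠ q : ℕ × ℝ in atTop ×ˢ 𝓟 K, -r q ^ 2 / 2 ≤ q.2 := by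
    filter_upwards [hmem, hr.eventually_ge_atTop 1, hr.eventually_ge_atTop (2 * M)] with q h1 h2 h3
    nlinarith [h1.1]
  have hlim : Tendsto (fun q => ∫ s in Set.Ioi (0 : ℝ),
      d * r q * (if ⌊d * r q * s⌋₊ < q.1 then f q ⌊d * r q * s⌋₊ else 0)) (atTop ×ˢ 𝓟 K)
      (nhds (∫ s in Set.Ioi (0 : ℝ),
        d * (∫ v in Set.Ioi (0 : ℝ), Real.exp (s * v - v ^ 2 / 2))⁻¹)) := by
    refine tendsto_integral_filter_of_dominated_convergence
      (fun s => 4 * d * Real.exp (M + 5 / 2) * Real.exp (-(1 / 2) * s)) ?_ ?_ ?_ ?_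
    · refine Eventually.of_forall fun q => Measurable.aestronglyMeasurable ?_
      have : Measurable fun k : ℕ => d * r q * (if k < q.1 then f q k else 0) :=
        measurable_from_nat
      exact this.comp (Nat.measurable_floor.comp (measurable_const_mul _))
    · filter_upwards [hmem, hlt, hr.eventually_ge_atTop 2] with q h1 h2 h3
      refine (ae_restrict_iff' measurableSet_Ioi).mpr (Eventually.of_forall fun s hs => ?_)
      have hr0 : 0 < r q := by linarith
      split_ifs with hk
      · have hapos : 0 < r q ^ 2 - σ s q * r q := by
          rw [← hindex q s hr0]
          exact div_pos (sub_pos.mpr (by exact_mod_cast hk)) hd0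
        have hσ0 : 0 ≤ σ s q := by positivity
        have hσs : s - 1 ≤ σ s q := by
          have hdr : 1 ≤ d * r q := by nlinarith
          have := Nat.lt_floor_add_one (d * r q * s)
          simp only [σ]
          rw [le_div_iff₀ (by positivity)]
          nlinarith
        have hbase : 1 / 2 ≤ 1 + q.2 / r q ^ 2 := by
          have : -(1 / 2) ≤ q.2 / r q ^ 2 := by
            rw [le_div_iff₀ (by positivity)]
            linarith
          linarith
        have hbase1 : 1 + q.2 / r q ^ 2 ≤ 1 := by
          have := div_nonpos_of_nonpos_of_nonneg h1.2 (sq_nonneg (r q))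
          linarith
        have hE := exp_le_edgeIntegral h3 hσ0 hapos
        have hEpos : 0 < edgeIntegral (r q) (σ s q) := lt_of_lt_of_le (by positivity) hE
        have hinv : (edgeIntegral (r q) (σ s q))⁻¹ ≤ 2 * Real.exp (5 / 2 + -(1 / 2) * s) :=
          calc (edgeIntegral (r q) (σ s q))⁻¹ ≤ (Real.exp (-2 + σ s q / 2) / 2)⁻¹ :=
                inv_anti₀ (by positivity) hE
            _ = 2 * Real.exp (-(-2 + σ s q / 2)) := by rw [Real.exp_neg, inv_div, div_eq_mul_inv]
            _ ≤ _ := by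
              gcongr
              linarith
        have hpow0 : 0 ≤ (1 + q.2 / r q ^ 2) ^ (r q ^ 2 - σ s q * r q - 1) :=
          Real.rpow_nonneg (by linarith) _
        rw [hsummand q s hr0 (by nlinarith), Real.norm_of_nonneg (by positivity)]
        calc d * ((1 + q.2 / r q ^ 2) ^ (r q ^ 2 - σ s q * r q - 1) * Real.exp (-q.2) *
              (edgeIntegral (r q) (σ s q))⁻¹)
            ≤ d * (2 * Real.exp M * (2 * Real.exp (5 / 2 + -(1 / 2) * s))) := by
              gcongr
              · exact rpow_le_two hbase hbase1 (by linarith)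
              · linarith [h1.1]
          _ = _ := by
              rw [Real.exp_add, Real.exp_add]
              ring
      · rw [mul_zero, norm_zero]
        positivity
    · exact (exp_neg_integrableOn_Ioi 0 (by norm_num : (0 : ℝ) < 1 / 2)).const_mul _
    · refine (ae_restrict_iff' measurableSet_Ioi).mpr (Eventually.of_forall fun s hs => ?_)
      have h := ((tendsto_one_add_div_sq_rpow_mul_exp_neg hr (hσ s hs) hmem).mul
        ((tendsto_edgeIntegral hr (hσ s hs)).inv₀
          (integral_exp_mul_sub_sq_pos s).ne')).const_mul d
      rw [one_mul] at h
      refine h.congr' ?_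
      filter_upwards [hlt, hr.eventually_gt_atTop 0, hr.eventually_gt_atTop s] with q h1 h2 h3
      have hk : ⌊d * r q * s⌋₊ < q.1 := by
        have hn : (q.1 : ℝ) = d * r q * r q := by
          have := hrsq q
          field_simp at this
          linarith
        rw [Nat.floor_lt (by have : 0 < s := hs; positivity), hn]
        gcongr
      rw [if_pos hk, hsummand q s h2 (by nlinarith)]
  rw [integral_const_mul, integral_Ioi_inv_integral_exp_mul_sub_sq] at hlim
  refine hlim.congr' ?_
  filter_upwards [hr.eventually_gt_atTop 0] with q hq
  exact (sum_range_eq_integral_floor q.1 (f q) (mul_pos hd0 hq)).symm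
end

section
/- For every fixed ξ ≤ 0: lim_{n→∞} Σ_{k=0}^{n−1} x_{n,k}(ξ) = −ξ. -/
open MeasureTheory Filter Finset

/-- `V_{n,k}(r) = Q(r) − (2 − (2k+1)/n) log r`. -/
noncomputable def Vnk (Q : ℝ → ℝ) (n k : ℕ) (r : ℝ) : ℝ :=
  Q r - (2 - (2 * (k : ℝ) + 1) / n) * Real.log r

/-- The rescaled radius `x_n(ξ) = R₀ + ξ/(n R₀ δ log 4)`. -/
noncomputable def xn (R₀ δ : ℝ) (n : ℕ) (ξ : ℝ) : ℝ :=
  R₀ + ξ / (n * R₀ * δ * Real.log 4)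

/-- The gap-probability factor
`x_{n,k}(ξ) = (∫_{x_n(ξ)}^{R₀} e^{−n V_{n,k}(r)} dr) / (∫_{r₀}^{R₀} e^{−n V_{n,k}(r)} dr)`. -/
noncomputable def xnk (Q : ℝ → ℝ) (r₀ R₀ δ : ℝ) (n k : ℕ) (ξ : ℝ) : ℝ :=
  (∫ r in (xn R₀ δ n ξ)..R₀, Real.exp (-(n : ℝ) * Vnk Q n k r)) /
  (∫ r in r₀..R₀, Real.exp (-(n : ℝ) * Vnk Q n k r))

lemma integral_exp_linear_sub_sq {β : ℝ} (hβ : 0 < β) (s : ℝ) :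
    ∫ y in Set.Ioi (0 : ℝ), Real.exp (2 * s * y - β * y ^ 2) =
      Real.exp (s ^ 2 / β) *
        (√(Real.pi / β) / 2 + ∫ u in (0 : ℝ)..(s / β), Real.exp (-β * u ^ 2)) := by
  have hint : Integrable fun u : ℝ => Real.exp (-β * u ^ 2) := integrable_exp_neg_mul_sq hβ
  have hshift : ∫ y in Set.Ioi (0 : ℝ), Real.exp (-β * (y - s / β) ^ 2) =
      ∫ u in Set.Ioi (-(s / β)), Real.exp (-β * u ^ 2) := by
    have h := (measurePreserving_sub_right volume (s / β)).setIntegral_preimage_emb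
      (measurableEmbedding_subRight (s / β)) (fun u : ℝ => Real.exp (-β * u ^ 2))
      (Set.Ioi (-(s / β)))
    rw [← h]
    congr 2
    ext y
    simp
  have hneg : ∫ u in (-(s / β))..0, Real.exp (-β * u ^ 2) =
      ∫ u in (0 : ℝ)..(s / β), Real.exp (-β * u ^ 2) := by
    have h := intervalIntegral.integral_comp_neg (a := 0) (b := s / β)
      (fun u : ℝ => Real.exp (-β * u ^ 2))
    simpa using h.symm
  have hsplit := intervalIntegral.integral_interval_add_Ioi
    (hint.integrableOn (s := Set.Ioi (-(s / β)))) (hint.integrableOn (s := Set.Ioi 0))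
  rw [hneg, integral_gaussian_Ioi] at hsplit
  rw [add_comm, hsplit, ← hshift, ← integral_const_mul]
  congr 1
  ext y
  rw [← Real.exp_add]
  congr 1
  field_simp
  ring

/-- The integrand is the derivative of `β log ψ(s / β)`, where `ψ(t) = ∫_{-∞}^t e^{-βu²} du`. -/
lemma integral_inv_integral_exp_linear_sub_sq {β : ℝ} (hβ : 0 < β) :
    ∫ s in Set.Ioi (0 : ℝ), (∫ y in Set.Ioi (0 : ℝ), Real.exp (2 * s * y - β * y ^ 2))⁻¹ =
      β * Real.log 2 := by
  set ψ : ℝ → ℝ := fun t => √(Real.pi / β) / 2 + ∫ u in (0 : ℝ)..t, Real.exp (-β * u ^ 2) with hψ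
  have hcont : Continuous fun u : ℝ => Real.exp (-β * u ^ 2) := by fun_prop
  have hsq : 0 < √(Real.pi / β) := Real.sqrt_pos.2 (div_pos Real.pi_pos hβ)
  have hpos : ∀ t, 0 ≤ t → 0 < ψ t := fun t ht =>
    add_pos_of_pos_of_nonneg (by positivity)
      (intervalIntegral.integral_nonneg ht fun u _ => (Real.exp_pos _).le)
  have hderiv : ∀ t, HasDerivAt ψ (Real.exp (-β * t ^ 2)) t := fun t =>
    (intervalIntegral.integral_hasDerivAt_right (hcont.intervalIntegrable _ _)
      hcont.stronglyMeasurable.stronglyMeasurableAtFilter hcont.continuousAt).const_add _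
  have hlim : Tendsto ψ atTop (nhds √(Real.pi / β)) := by
    have h := (intervalIntegral_tendsto_integral_Ioi 0
      (integrable_exp_neg_mul_sq hβ).integrableOn tendsto_id).const_add (√(Real.pi / β) / 2)
    rw [integral_gaussian_Ioi, add_halves] at h
    exact h
  have hmain := integral_Ioi_of_hasDerivAt_of_nonneg' (a := 0)
    (g := fun s => β * Real.log (ψ (s / β)))
    (g' := fun s => (∫ y in Set.Ioi (0 : ℝ), Real.exp (2 * s * y - β * y ^ 2))⁻¹)
    (l := β * Real.log √(Real.pi / β)) ?_ ?_ ?_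
  · rw [hmain, ← mul_sub, ← Real.log_div hsq.ne' (hpos _ (by simp)).ne']
    congr 2
    simp only [hψ, zero_div, intervalIntegral.integral_same, add_zero]
    field_simp
  · intro s hs
    have hs' : 0 ≤ s / β := div_nonneg hs hβ.le
    have h := (((hderiv (s / β)).comp s ((hasDerivAt_id s).div_const β)).log
      (by exact (hpos _ hs').ne')).const_mul β
    refine h.congr_deriv ?_
    rw [integral_exp_linear_sub_sq hβ]
    change _ = (Real.exp (s ^ 2 / β) * ψ (s / β))⁻¹
    have he : Real.exp (-β * (s / β) ^ 2) = (Real.exp (s ^ 2 / β))⁻¹ := by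
      rw [← Real.exp_neg]
      congr 1
      field_simp
    have := (hpos _ hs').ne'
    simp only [Function.comp, id, he]
    field_simp
  · intro s _
    exact inv_nonneg.2 (integral_nonneg fun y => (Real.exp_pos _).le)
  · have h := hlim.comp (tendsto_id.atTop_div_const hβ)
    exact (h.log hsq.ne').const_mul β

lemma sum_range_eq_integral_floor_s13 (a : ℕ → ℝ) (n : ℕ) :
    ∑ k ∈ Finset.range n, a k = ∫ u in (0 : ℝ)..n, a ⌊u⌋₊ := by
  have hae : ∀ k : ℕ, ∀ᵐ u : ℝ, u ∈ Set.uIoc (k : ℝ) ((k + 1 : ℕ) : ℝ) → a k = a ⌊u⌋₊ := by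
    intro k
    filter_upwards [Measure.ae_ne volume ((k + 1 : ℕ) : ℝ)] with u hu hmem
    rw [Set.uIoc_of_le (by simp)] at hmem
    rw [(Nat.floor_eq_iff (k.cast_nonneg.trans hmem.1.le)).2
      ⟨hmem.1.le, by exact_mod_cast lt_of_le_of_ne hmem.2 hu⟩]
  have h := intervalIntegral.sum_integral_adjacent_intervals (μ := volume)
    (f := fun u : ℝ => a ⌊u⌋₊) (a := fun k : ℕ => (k : ℝ)) (n := n) fun k _ =>
      (intervalIntegrable_const (c := a k)).congr_ae
        ((ae_restrict_iff' measurableSet_uIoc).2 (hae k))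
  rw [Nat.cast_zero] at h
  rw [← h]
  refine Finset.sum_congr rfl fun k _ => ?_
  rw [← intervalIntegral.integral_congr_ae (hae k)]
  simp

lemma sum_range_eq_setIntegral_floor_sqrt (a : ℕ → ℝ) (n : ℕ) :
    ∑ k ∈ Finset.range n, a k =
      ∫ s in Set.Ioi (0 : ℝ), (Set.Iic √n).indicator (fun s => √n * a ⌊s * √n⌋₊) s := by
  rw [sum_range_eq_integral_floor_s13, setIntegral_indicator measurableSet_Iic, Set.Ioi_inter_Iic,
    ← intervalIntegral.integral_of_le (Real.sqrt_nonneg _), intervalIntegral.integral_const_mul]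
  have h := intervalIntegral.mul_integral_comp_mul_right (a := 0) (b := √(n : ℝ))
    (f := fun u : ℝ => a ⌊u⌋₊) (c := √(n : ℝ))
  rw [h, zero_mul, Real.mul_self_sqrt n.cast_nonneg]

/-- If `g(v) ≤ A v²`, then `√n ∫₀ᴸ e^{-n g(v) + 2kv} dv ≥ c (1 + k²/n)`, uniformly in `n` and `k`. -/
lemma lower_bound_integral_exp {g : ℝ → ℝ} {L A : ℝ} (hg : Continuous g) (hL : 0 < L)
    (hA : 0 < A) (hup : ∀ v ∈ Set.Icc 0 L, g v ≤ A * v ^ 2) :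
    ∃ c > 0, ∀ n k : ℕ, 0 < n → c * (1 + (k / √n) ^ 2) ≤
      √n * ∫ v in (0 : ℝ)..L, Real.exp (-(n * g v) + 2 * k * v) := by
  set l := min L 1 with hl
  have hl0 : 0 < l := lt_min hL one_pos
  have hl1 : l ≤ 1 := min_le_right _ _
  refine ⟨Real.exp (-A) * l ^ 3 / 2, by positivity, fun n k hn => ?_⟩
  have hn1 : (1 : ℝ) ≤ n := by exact_mod_cast hn
  have hs1 : 1 ≤ √(n : ℝ) := Real.one_le_sqrt.2 hn1
  have hs0 : 0 < √(n : ℝ) := by linarith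
  have hss : √(n : ℝ) ^ 2 = n := Real.sq_sqrt (by linarith)
  have hlL : l / √n ≤ L := (div_le_self hl0.le hs1).trans (min_le_left _ _)
  have hl' : 0 ≤ l / √n := by positivity
  have hcont : Continuous fun v : ℝ => Real.exp (-(n * g v) + 2 * k * v) := by fun_prop
  have hle : ∫ v in (0 : ℝ)..(l / √n), Real.exp (-A) * (1 + 2 * (k : ℝ) ^ 2 * v ^ 2) ≤
      ∫ v in (0 : ℝ)..L, Real.exp (-(n * g v) + 2 * k * v) := by
    refine le_trans (intervalIntegral.integral_mono_on hl'
      (Continuous.intervalIntegrable (by fun_prop) _ _) (hcont.intervalIntegrable _ _)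
      fun v hv => ?_) (intervalIntegral.integral_mono_interval le_rfl hl' hlL
        (ae_of_all _ fun v => (Real.exp_pos _).le) (hcont.intervalIntegrable _ _))
    rw [Real.exp_add]
    have hv2 : n * v ^ 2 ≤ 1 := by
      have h1 : √n * v ≤ l := by rw [mul_comm]; exact (le_div_iff₀ hs0).1 hv.2
      have h2 : 0 ≤ √n * v := mul_nonneg hs0.le hv.1
      rw [← hss, ← mul_pow]
      nlinarith
    have hgv := hup v ⟨hv.1, hv.2.trans hlL⟩
    have hq := Real.quadratic_le_exp_of_nonneg
      (mul_nonneg (by positivity : (0 : ℝ) ≤ 2 * k) hv.1)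
    refine mul_le_mul (Real.exp_le_exp.2 ?_) ?_ (by positivity) (Real.exp_pos _).le
    · nlinarith
    · have : 0 ≤ 2 * (k : ℝ) * v := mul_nonneg (by positivity) hv.1
      nlinarith
  have hcalc : ∫ v in (0 : ℝ)..(l / √n), Real.exp (-A) * (1 + 2 * (k : ℝ) ^ 2 * v ^ 2) =
      Real.exp (-A) * (l / √n + 2 * (k : ℝ) ^ 2 * ((l / √n) ^ 3 / 3)) := by
    rw [intervalIntegral.integral_const_mul, intervalIntegral.integral_add
      (Continuous.intervalIntegrable (by fun_prop) _ _)
      (Continuous.intervalIntegrable (by fun_prop) _ _),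
      intervalIntegral.integral_const_mul, integral_pow]
    norm_num
  have hl3 : l ^ 3 ≤ l := by nlinarith [mul_nonneg hl0.le hl0.le]
  have hk : 0 ≤ (k / √n) ^ 2 := by positivity
  calc Real.exp (-A) * l ^ 3 / 2 * (1 + (k / √n) ^ 2)
      = Real.exp (-A) * (l ^ 3 / 2 + l ^ 3 / 2 * (k / √n) ^ 2) := by ring
    _ ≤ Real.exp (-A) * (l + 2 / 3 * l ^ 3 * (k / √n) ^ 2) := by
      refine mul_le_mul_of_nonneg_left ?_ (Real.exp_pos _).le
      have : 0 ≤ l ^ 3 * (k / √n) ^ 2 := by positivity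
      nlinarith
    _ = √n * (Real.exp (-A) * (l / √n + 2 * (k : ℝ) ^ 2 * ((l / √n) ^ 3 / 3))) := by
      field_simp
    _ ≤ _ := by
      rw [← hcalc]
      exact mul_le_mul_of_nonneg_left hle hs0.le

lemma tendsto_sqrt_mul_integral_exp {g : ℝ → ℝ} {L a β s : ℝ} (hg : Continuous g) (hL : 0 < L)
    (ha : 0 < a) (hlow : ∀ v ∈ Set.Icc 0 L, a * v ^ 2 ≤ g v)
    (hlim : Tendsto (fun v => g v / v ^ 2) (nhdsWithin 0 (Set.Ioi 0)) (nhds β))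
    {k : ℕ → ℕ} (hk : Tendsto (fun n : ℕ => (k n : ℝ) / √n) atTop (nhds s))
    (hks : ∀ n, (k n : ℝ) / √n ≤ s) :
    Tendsto (fun n : ℕ => √n * ∫ v in (0 : ℝ)..L, Real.exp (-(n * g v) + 2 * k n * v)) atTop
      (nhds (∫ y in Set.Ioi (0 : ℝ), Real.exp (2 * s * y - β * y ^ 2))) := by
  have hsqrt : Tendsto (fun n : ℕ => √(n : ℝ)) atTop atTop :=
    Real.tendsto_sqrt_atTop.comp tendsto_natCast_atTop_atTop
  have hscale : ∀ᶠ n : ℕ in atTop,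
      ∫ y in Set.Ioi (0 : ℝ), (Set.Iic (L * √n)).indicator
        (fun y => Real.exp (-(n * g (y / √n)) + 2 * (k n / √n) * y)) y =
      √n * ∫ v in (0 : ℝ)..L, Real.exp (-(n * g v) + 2 * k n * v) := by
    filter_upwards [eventually_gt_atTop 0] with n hn
    have hs0 : 0 < √(n : ℝ) := Real.sqrt_pos.2 (by exact_mod_cast hn)
    rw [setIntegral_indicator measurableSet_Iic, Set.Ioi_inter_Iic,
      ← intervalIntegral.integral_of_le (by positivity)]
    have h := intervalIntegral.integral_comp_div (a := 0) (b := L * √n)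
      (fun v => Real.exp (-(n * g v) + 2 * k n * v)) hs0.ne'
    rw [zero_div, mul_div_cancel_right₀ _ hs0.ne', smul_eq_mul] at h
    rw [← h]
    refine intervalIntegral.integral_congr fun y _ => ?_
    congr 2
    ring
  refine Tendsto.congr' hscale ?_
  refine tendsto_integral_filter_of_dominated_convergence
    (fun y => Real.exp (2 * s ^ 2 / a) * Real.exp (-(a / 2) * y ^ 2)) ?_ ?_ ?_ ?_
  · refine Eventually.of_forall fun n =>
      (Measurable.indicator ?_ measurableSet_Iic).aestronglyMeasurable
    exact Continuous.measurable (by fun_prop)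
  · filter_upwards [eventually_gt_atTop 0] with n hn
    filter_upwards [ae_restrict_mem measurableSet_Ioi] with y hy
    rw [Set.mem_Ioi] at hy
    have hs0 : 0 < √(n : ℝ) := Real.sqrt_pos.2 (by exact_mod_cast hn)
    have hss : √(n : ℝ) ^ 2 = n := Real.sq_sqrt n.cast_nonneg
    by_cases hyL : y ∈ Set.Iic (L * √n)
    · rw [Set.indicator_of_mem hyL, Real.norm_eq_abs, Real.abs_exp, ← Real.exp_add]
      refine Real.exp_le_exp.2 ?_
      have h1 := hlow (y / √n) ⟨by positivity, (div_le_iff₀ hs0).2 hyL⟩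
      have h2 : a * y ^ 2 ≤ n * g (y / √n) := by
        rw [div_pow, hss] at h1
        have hn0 : (0 : ℝ) < n := by exact_mod_cast hn
        calc a * y ^ 2 = n * (a * (y ^ 2 / n)) := by field_simp
          _ ≤ _ := mul_le_mul_of_nonneg_left h1 hn0.le
      have h3 : (k n : ℝ) / √n * y ≤ s * y := mul_le_mul_of_nonneg_right (hks n) hy.le
      have h4 : 2 * s * y ≤ 2 * s ^ 2 / a + a / 2 * y ^ 2 := by
        have : 2 * s ^ 2 / a + a / 2 * y ^ 2 - 2 * s * y = (2 * s - a * y) ^ 2 / (2 * a) := by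
          field_simp
          ring
        have : 0 ≤ (2 * s - a * y) ^ 2 / (2 * a) := by positivity
        linarith
      linarith
    · rw [Set.indicator_of_notMem hyL, norm_zero]
      positivity
  · exact ((integrable_exp_neg_mul_sq (half_pos ha)).const_mul _).integrableOn
  · filter_upwards [ae_restrict_mem measurableSet_Ioi] with y hy
    rw [Set.mem_Ioi] at hy
    have hv : Tendsto (fun n : ℕ => y / √(n : ℝ)) atTop (nhdsWithin 0 (Set.Ioi 0)) := by
      refine tendsto_nhdsWithin_iff.2 ⟨hsqrt.const_div_atTop y, ?_⟩
      filter_upwards [hsqrt.eventually_gt_atTop 0] with n hn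
      exact div_pos hy hn
    have h1 := ((hlim.comp hv).mul_const (y ^ 2)).neg.add ((hk.const_mul 2).mul_const y)
    have h2 := (Real.continuous_exp.tendsto _).comp h1
    rw [show 2 * s * y - β * y ^ 2 = -(β * y ^ 2) + 2 * s * y by ring]
    refine h2.congr' ?_
    filter_upwards [eventually_gt_atTop 0, hsqrt.eventually_ge_atTop (y / L)] with n hn hyn
    rw [Set.indicator_of_mem (Set.mem_Iic.2 ((div_le_iff₀' hL).1 hyn))]
    have hss : √(n : ℝ) ^ 2 = n := Real.sq_sqrt n.cast_nonneg
    have hn0 : (0 : ℝ) < n := by exact_mod_cast hn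
    simp only [Function.comp]
    rw [div_pow, hss]
    congr 3
    field_simp

lemma integral_exp_le_of_nonneg {g : ℝ → ℝ} {L w : ℝ} (hg : Continuous g)
    (hlow : ∀ v ∈ Set.Icc 0 L, 0 ≤ g v) (hw : w ∈ Set.Icc 0 L) (n k : ℕ) :
    ∫ v in (0 : ℝ)..w, Real.exp (-(n * g v) + 2 * k * v) ≤ w * Real.exp (2 * k * w) := by
  have h : ∫ v in (0 : ℝ)..w, Real.exp (-(n * g v) + 2 * k * v) ≤
      ∫ _ in (0 : ℝ)..w, Real.exp (2 * k * w) := by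
    refine intervalIntegral.integral_mono_on hw.1
      (Continuous.intervalIntegrable (by fun_prop) _ _) (by simp) fun v hv => ?_
    have h1 := hlow v ⟨hv.1, hv.2.trans hw.2⟩
    have h2 : 2 * (k : ℝ) * v ≤ 2 * k * w := mul_le_mul_of_nonneg_left hv.2 (by positivity)
    exact Real.exp_le_exp.2 (by nlinarith [mul_nonneg n.cast_nonneg h1])
  simpa using h

lemma le_integral_exp {g : ℝ → ℝ} {L A w : ℝ} (hg : Continuous g) (hA : 0 < A)
    (hup : ∀ v ∈ Set.Icc 0 L, g v ≤ A * v ^ 2) (hw : w ∈ Set.Icc 0 L) (n k : ℕ) :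
    w * Real.exp (-(n * (A * w ^ 2))) ≤
      ∫ v in (0 : ℝ)..w, Real.exp (-(n * g v) + 2 * k * v) := by
  have h : ∫ _ in (0 : ℝ)..w, Real.exp (-(n * (A * w ^ 2))) ≤
      ∫ v in (0 : ℝ)..w, Real.exp (-(n * g v) + 2 * k * v) := by
    refine intervalIntegral.integral_mono_on hw.1 (by simp)
      (Continuous.intervalIntegrable (by fun_prop) _ _) fun v hv => ?_
    have h1 := hup v ⟨hv.1, hv.2.trans hw.2⟩
    have h2 : 0 ≤ 2 * (k : ℝ) * v := mul_nonneg (by positivity) hv.1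
    have h3 : A * v ^ 2 ≤ A * w ^ 2 :=
      mul_le_mul_of_nonneg_left (pow_le_pow_left₀ hv.1 hv.2 2) hA.le
    have h4 := mul_le_mul_of_nonneg_left (h1.trans h3) n.cast_nonneg (α := ℝ)
    exact Real.exp_le_exp.2 (by linarith)
  simpa using h

/-- If `g(v) ~ β v²` at `0⁺`, `g` is comparable to `v²` on `[0, L]` and `n wₙ → c`, then
`Σ_{k<n} (∫₀^{wₙ} e^{-n g(v) + 2kv} dv) / (∫₀ᴸ e^{-n g(v) + 2kv} dv) → c β log 2`. The sum is an
integral of a step function in `s = k / √n`, to which dominated convergence applies. -/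
theorem tendsto_sum_integral_exp_div {g : ℝ → ℝ} {L a A β c : ℝ} {w : ℕ → ℝ}
    (hg : Continuous g) (hL : 0 < L) (ha : 0 < a) (hA : 0 < A) (hβ : 0 < β)
    (hlow : ∀ v ∈ Set.Icc 0 L, a * v ^ 2 ≤ g v) (hup : ∀ v ∈ Set.Icc 0 L, g v ≤ A * v ^ 2)
    (hlim : Tendsto (fun v => g v / v ^ 2) (nhdsWithin 0 (Set.Ioi 0)) (nhds β))
    (hw0 : ∀ᶠ n in atTop, 0 ≤ w n) (hw : Tendsto (fun n : ℕ => n * w n) atTop (nhds c)) :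
    Tendsto (fun n : ℕ => ∑ k ∈ Finset.range n,
      (∫ v in (0 : ℝ)..w n, Real.exp (-(n * g v) + 2 * k * v)) /
        ∫ v in (0 : ℝ)..L, Real.exp (-(n * g v) + 2 * k * v)) atTop
      (nhds (c * (β * Real.log 2))) := by
  set N : ℕ → ℕ → ℝ := fun n k => ∫ v in (0 : ℝ)..w n, Real.exp (-(n * g v) + 2 * k * v) with hN
  set D : ℕ → ℕ → ℝ := fun n k => ∫ v in (0 : ℝ)..L, Real.exp (-(n * g v) + 2 * k * v) with hD
  have hsqrt : Tendsto (fun n : ℕ => √(n : ℝ)) atTop atTop :=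
    Real.tendsto_sqrt_atTop.comp tendsto_natCast_atTop_atTop
  have hwlim : Tendsto w atTop (nhds 0) := by
    refine (hw.div_atTop tendsto_natCast_atTop_atTop).congr' ?_
    filter_upwards [eventually_gt_atTop 0] with n hn
    have : (n : ℝ) ≠ 0 := by exact_mod_cast hn.ne'
    field_simp
  have hwmem : ∀ᶠ n in atTop, w n ∈ Set.Icc 0 L := by
    filter_upwards [hw0, hwlim.eventually_le_const hL] with n h1 h2 using ⟨h1, h2⟩
  have hg0 : ∀ v ∈ Set.Icc 0 L, 0 ≤ g v := fun v hv =>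
    (mul_nonneg ha.le (sq_nonneg v)).trans (hlow v hv)
  obtain ⟨d, hd, hDlow⟩ := lower_bound_integral_exp hg hL hA hup
  have hrw : ∀ n k : ℕ, 0 < n → √n * (N n k / D n k) = n * N n k / (√n * D n k) := by
    intro n k hn
    have hs0 : 0 < √(n : ℝ) := Real.sqrt_pos.2 (by exact_mod_cast hn)
    nth_rewrite 2 [← Real.mul_self_sqrt n.cast_nonneg]
    rw [mul_assoc, mul_div_mul_left _ _ hs0.ne', mul_div_assoc]
  rw [← integral_inv_integral_exp_linear_sub_sq hβ, ← integral_const_mul]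
  simp_rw [sum_range_eq_setIntegral_floor_sqrt]
  refine tendsto_integral_filter_of_dominated_convergence
    (fun s => 3 * ((c + 1) * Real.exp (2 * (c + 1))) / d * (1 + s ^ 2)⁻¹) ?_ ?_ ?_ ?_
  · refine Eventually.of_forall fun n =>
      (Measurable.indicator ?_ measurableSet_Iic).aestronglyMeasurable
    exact ((measurable_from_nat (f := fun k => N n k / D n k)).comp
      (Nat.measurable_floor.comp (measurable_id.mul_const _))).const_mul _
  · filter_upwards [eventually_gt_atTop 0, hwmem, hw.eventually_le_const (lt_add_one c)]
      with n hn hwn hnw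
    filter_upwards [ae_restrict_mem measurableSet_Ioi] with s hs
    rw [Set.mem_Ioi] at hs
    have hn1 : (1 : ℝ) ≤ n := by exact_mod_cast hn
    have hs1 : 1 ≤ √(n : ℝ) := Real.one_le_sqrt.2 hn1
    have hs0 : 0 < √(n : ℝ) := by linarith
    have hc1 : 0 ≤ c + 1 := (mul_nonneg n.cast_nonneg hwn.1).trans hnw
    by_cases hsn : s ∈ Set.Iic √(n : ℝ)
    swap
    · rw [Set.indicator_of_notMem hsn, norm_zero]
      positivity
    rw [Set.indicator_of_mem hsn]
    set k := ⌊s * √n⌋₊ with hk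
    have hkn : (k : ℝ) ≤ n := by
      refine (Nat.floor_le (by positivity)).trans ?_
      have h := mul_le_mul_of_nonneg_right (Set.mem_Iic.1 hsn) hs0.le
      rwa [Real.mul_self_sqrt n.cast_nonneg] at h
    change ‖√n * (N n k / D n k)‖ ≤ _
    have hNn : 0 ≤ N n k :=
      intervalIntegral.integral_nonneg hwn.1 fun v _ => (Real.exp_pos _).le
    have hNle : n * N n k ≤ (c + 1) * Real.exp (2 * (c + 1)) := by
      have h1 := integral_exp_le_of_nonneg hg hg0 hwn n k
      have h2 : 2 * (k : ℝ) * w n ≤ 2 * (c + 1) := by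
        have := mul_le_mul_of_nonneg_right hkn hwn.1
        linarith
      calc n * N n k ≤ n * (w n * Real.exp (2 * k * w n)) :=
            mul_le_mul_of_nonneg_left h1 n.cast_nonneg
        _ = n * w n * Real.exp (2 * k * w n) := by ring
        _ ≤ _ := mul_le_mul hnw (Real.exp_le_exp.2 h2) (Real.exp_pos _).le hc1
    have hDle : d / 3 * (1 + s ^ 2) ≤ √n * D n k := by
      refine le_trans ?_ (hDlow n k hn)
      have h1 : s ≤ k / √n + 1 := by
        have h2 := (Nat.lt_floor_add_one (s * √n)).le
        rw [← hk] at h2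
        have h3 : s ≤ (k + 1) / √n := (le_div_iff₀ hs0).2 h2
        rw [add_div] at h3
        have h4 : 1 / √(n : ℝ) ≤ 1 := (div_le_one hs0).2 hs1
        linarith
      have h5 : 1 + s ^ 2 ≤ 3 * (1 + (k / √n) ^ 2) := by
        have := pow_le_pow_left₀ hs.le h1 2
        nlinarith [sq_nonneg ((k : ℝ) / √n - 1)]
      calc d / 3 * (1 + s ^ 2) ≤ d / 3 * (3 * (1 + (k / √n) ^ 2)) :=
            mul_le_mul_of_nonneg_left h5 (by positivity)
        _ = _ := by ring
    have hD0 : 0 < d / 3 * (1 + s ^ 2) := by positivity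
    rw [hrw n k hn, Real.norm_of_nonneg
      (div_nonneg (mul_nonneg n.cast_nonneg hNn) (hD0.le.trans hDle))]
    refine (div_le_div₀ (by positivity) hNle hD0 hDle).trans (le_of_eq ?_)
    field_simp
  · exact (integrable_inv_one_add_sq.const_mul _).integrableOn
  · filter_upwards [ae_restrict_mem measurableSet_Ioi] with s hs
    rw [Set.mem_Ioi] at hs
    set k : ℕ → ℕ := fun n => ⌊s * √n⌋₊ with hk
    have hklim : Tendsto (fun n : ℕ => (k n : ℝ) / √n) atTop (nhds s) :=
      (tendsto_nat_floor_mul_div_atTop hs.le).comp hsqrt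
    have hks : ∀ n, (k n : ℝ) / √n ≤ s := fun n =>
      div_le_of_le_mul₀ (Real.sqrt_nonneg _) hs.le (Nat.floor_le (by positivity))
    have hDlim := tendsto_sqrt_mul_integral_exp hg hL ha hlow hlim hklim hks
    have hG : 0 < ∫ y in Set.Ioi (0 : ℝ), Real.exp (2 * s * y - β * y ^ 2) := by
      rw [integral_exp_linear_sub_sq hβ]
      have : 0 < √(Real.pi / β) := Real.sqrt_pos.2 (div_pos Real.pi_pos hβ)
      have : 0 ≤ ∫ u in (0 : ℝ)..(s / β), Real.exp (-β * u ^ 2) :=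
        intervalIntegral.integral_nonneg (by positivity) fun u _ => (Real.exp_pos _).le
      positivity
    have hkw : Tendsto (fun n : ℕ => 2 * (k n : ℝ) * w n) atTop (nhds 0) := by
      have h := ((hklim.const_mul 2).mul hw).mul hsqrt.inv_tendsto_atTop
      rw [mul_zero] at h
      refine h.congr' ?_
      filter_upwards [eventually_gt_atTop 0] with n hn
      have hs0 : 0 < √(n : ℝ) := Real.sqrt_pos.2 (by exact_mod_cast hn)
      have hss : √(n : ℝ) ^ 2 = n := Real.sq_sqrt n.cast_nonneg
      simp only [Pi.inv_apply]
      field_simp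
      rw [hss]
    have hNlim : Tendsto (fun n => n * N n (k n)) atTop (nhds c) := by
      have hlo : Tendsto (fun n : ℕ => n * w n * Real.exp (-(n * w n * (A * w n)))) atTop
          (nhds c) := by
        have h := hw.mul ((Real.continuous_exp.tendsto _).comp
          (hw.mul (hwlim.const_mul A)).neg)
        simpa using h
      have hhi : Tendsto (fun n : ℕ => n * w n * Real.exp (2 * k n * w n)) atTop (nhds c) := by
        simpa using hw.mul ((Real.continuous_exp.tendsto _).comp hkw)
      refine tendsto_of_tendsto_of_tendsto_of_le_of_le' hlo hhi ?_ ?_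
      · filter_upwards [hwmem] with n hwn
        have h := mul_le_mul_of_nonneg_left (le_integral_exp hg hA hup hwn n (k n))
          (n.cast_nonneg (α := ℝ))
        rw [← mul_assoc] at h
        refine le_trans (le_of_eq ?_) h
        congr 3
        ring
      · filter_upwards [hwmem] with n hwn
        have h := mul_le_mul_of_nonneg_left (integral_exp_le_of_nonneg hg hg0 hwn n (k n))
          (n.cast_nonneg (α := ℝ))
        rwa [← mul_assoc] at h
    rw [← div_eq_mul_inv]
    refine (hNlim.div hDlim hG.ne').congr' ?_
    filter_upwards [eventually_gt_atTop 0, hsqrt.eventually_ge_atTop s] with n hn hsn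
    rw [Set.indicator_of_mem (Set.mem_Iic.2 hsn)]
    exact (hrw n (k n) hn).symm

lemma tendsto_div_sq_of_hasDerivAt {g g' : ℝ → ℝ} {β : ℝ} (hg : ∀ v, HasDerivAt g (g' v) v)
    (hg' : HasDerivAt g' (2 * β) 0) (hg0 : g 0 = 0) (hg'0 : g' 0 = 0) :
    Tendsto (fun v => g v / v ^ 2) (nhdsWithin 0 (Set.Ioi 0)) (nhds β) := by
  refine HasDerivAt.lhopital_zero_nhdsGT (f' := g') (g' := fun v => 2 * v)
    (Eventually.of_forall hg) (Eventually.of_forall fun v => by simpa using hasDerivAt_pow 2 v)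
    ?_ ?_ ?_ ?_
  · filter_upwards [self_mem_nhdsWithin] with v hv
    exact mul_ne_zero two_ne_zero (ne_of_gt hv)
  · simpa [hg0] using (hg 0).continuousAt.tendsto.mono_left (nhdsWithin_le_nhds (s := Set.Ioi 0))
  · have : Continuous fun v : ℝ => v ^ 2 := by fun_prop
    simpa using (this.tendsto 0).mono_left (nhdsWithin_le_nhds (s := Set.Ioi 0))
  · have h := (hasDerivAt_iff_tendsto_slope.1 hg').mono_left
      (nhdsWithin_mono 0 fun v (hv : v ∈ Set.Ioi (0 : ℝ)) => ne_of_gt hv)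
    have h2 := h.div_const 2
    rw [mul_div_cancel_left₀ _ two_ne_zero] at h2
    refine h2.congr fun v => ?_
    rw [slope_def_field, hg'0, sub_zero, sub_zero, div_div, mul_comm]

lemma exists_quadratic_bounds {g : ℝ → ℝ} {L β : ℝ} (hg : Continuous g) (hL : 0 < L)
    (hβ : 0 < β) (hg0 : g 0 = 0) (hpos : ∀ v > 0, 0 < g v)
    (hlim : Tendsto (fun v => g v / v ^ 2) (nhdsWithin 0 (Set.Ioi 0)) (nhds β)) :
    ∃ a > 0, ∃ A > 0, ∀ v ∈ Set.Icc 0 L, a * v ^ 2 ≤ g v ∧ g v ≤ A * v ^ 2 := by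
  set f : ℝ → ℝ := Function.update (fun v => g v / v ^ 2) 0 β with hf
  have hfne : ∀ v, v ≠ 0 → f v = g v / v ^ 2 := fun v hv => Function.update_of_ne hv _ _
  have hfpos : ∀ v ∈ Set.Icc 0 L, 0 < f v := by
    intro v hv
    rcases hv.1.eq_or_lt with rfl | h
    · simpa [hf] using hβ
    · rw [hfne v h.ne']
      exact div_pos (hpos v h) (by positivity)
  have hcont : ContinuousOn f (Set.Icc 0 L) := by
    intro v hv
    rcases hv.1.eq_or_lt with rfl | h
    · refine continuousWithinAt_update_same.2 (hlim.mono_left (nhdsWithin_mono 0 ?_))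
      exact fun u hu => lt_of_le_of_ne hu.1.1 (Ne.symm hu.2)
    · refine (continuousAt_update_of_ne h.ne').2 ?_ |>.continuousWithinAt
      exact hg.continuousAt.div (by fun_prop) (by positivity)
  have hne : (Set.Icc 0 L).Nonempty := Set.nonempty_Icc.2 hL.le
  obtain ⟨u, hu, hmin⟩ := isCompact_Icc.exists_isMinOn hne hcont
  obtain ⟨t, ht, hmax⟩ := isCompact_Icc.exists_isMaxOn hne hcont
  refine ⟨f u, hfpos u hu, f t, hfpos t ht, fun v hv => ?_⟩
  rcases hv.1.eq_or_lt with rfl | h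
  · simp [hg0]
  · have h1 := hmin hv
    have h2 := hmax hv
    simp only [Set.mem_ofPred_eq, hfne v h.ne'] at h1 h2
    exact ⟨(le_div_iff₀ (by positivity)).1 h1, (div_le_iff₀ (by positivity)).1 h2⟩

lemma pos_of_hasDerivAt_of_nonneg {g g' g'' : ℝ → ℝ} {β : ℝ} (hβ : 0 < β)
    (hg : ∀ v, HasDerivAt g (g' v) v) (hg' : ∀ v, HasDerivAt g' (g'' v) v)
    (hg'' : ∀ v, 0 ≤ g'' v) (hg'0 : g' 0 = 0)
    (hlim : Tendsto (fun v => g v / v ^ 2) (nhdsWithin 0 (Set.Ioi 0)) (nhds β)) :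
    ∀ v > 0, 0 < g v := by
  have hmono' : Monotone g' := monotone_of_hasDerivAt_nonneg hg' hg''
  have hmono : MonotoneOn g (Set.Ici 0) := by
    refine monotoneOn_of_deriv_nonneg (convex_Ici 0)
      (fun v _ => (hg v).continuousAt.continuousWithinAt)
      (fun v _ => (hg v).differentiableAt.differentiableWithinAt) fun v hv => ?_
    rw [(hg v).deriv, ← hg'0]
    exact hmono' (interior_subset hv)
  intro v hv
  obtain ⟨u, ⟨hu, huv⟩, hu0⟩ := ((hlim.eventually_const_lt hβ).and
    (Ioc_mem_nhdsGT hv)).exists.imp fun u hu => And.intro hu.2 hu.1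
  have : 0 < g u := by
    by_contra! h
    exact absurd hu0 (not_lt.2 (div_nonpos_of_nonpos_of_nonneg h (sq_nonneg u)))
  exact this.trans_le (hmono hu.le hv.le huv)

/-- The substitution `r = R e^{-v}`. -/
lemma integral_exp_Vnk_eq {Q : ℝ → ℝ} (hQ : ContinuousOn Q (Set.Ioi 0)) {R x : ℝ} (hR : 0 < R)
    (hx : 0 < x) {n : ℕ} (hn : 0 < n) (k : ℕ) :
    ∫ r in x..R, Real.exp (-(n : ℝ) * Vnk Q n k r) =
      Real.exp (-(n * Q R) + (2 * n - 2 * k) * Real.log R) *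
        ∫ v in (0 : ℝ)..Real.log (R / x),
          Real.exp (-(n * (Q (R * Real.exp (-v)) - Q R + 2 * v)) + 2 * k * v) := by
  have hn0 : (n : ℝ) ≠ 0 := by exact_mod_cast hn.ne'
  have hderiv : ∀ v : ℝ, HasDerivAt (fun v => R * Real.exp (-v)) (-(R * Real.exp (-v))) v :=
    fun v => by simpa using ((hasDerivAt_neg v).exp.const_mul R)
  have hsub := intervalIntegral.integral_comp_mul_deriv' (a := 0) (b := Real.log (R / x))
    (g := fun r => Real.exp (-(n : ℝ) * Vnk Q n k r)) (fun v _ => hderiv v)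
    (by fun_prop) ?_
  · have hend : R * Real.exp (-Real.log (R / x)) = x := by
      rw [Real.exp_neg, Real.exp_log (div_pos hR hx)]
      field_simp
    rw [hend, neg_zero, Real.exp_zero, mul_one] at hsub
    rw [intervalIntegral.integral_symm, ← hsub, ← intervalIntegral.integral_neg,
      ← intervalIntegral.integral_const_mul]
    refine intervalIntegral.integral_congr fun v _ => ?_
    have hRv : R * Real.exp (-v) = Real.exp (Real.log R - v) := by
      rw [sub_eq_add_neg, Real.exp_add, Real.exp_log hR]
    have hlog : Real.log (R * Real.exp (-v)) = Real.log R - v := by rw [hRv, Real.log_exp]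
    simp only [Function.comp, Vnk, hlog, mul_neg, neg_neg]
    nth_rewrite 2 [hRv]
    rw [← Real.exp_add, ← Real.exp_add]
    congr 1
    field_simp
    ring
  · have hpos : (fun v => R * Real.exp (-v)) '' Set.uIcc 0 (Real.log (R / x)) ⊆ Set.Ioi 0 := by
      rintro _ ⟨v, _, rfl⟩
      exact mul_pos hR (Real.exp_pos _)
    refine ContinuousOn.mono ?_ hpos
    unfold Vnk
    refine Real.continuous_exp.comp_continuousOn (continuousOn_const.mul
      (hQ.sub (continuousOn_const.mul ?_)))
    exact Real.continuousOn_log.mono fun r hr => ne_of_gt hr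

/-- For fixed `ξ ≤ 0`, `Σ_{k=0}^{n−1} x_{n,k}(ξ) → −ξ`. -/
theorem hard_edge_radial_sum_limit
    (Q : ℝ → ℝ) (r₀ R₀ δ : ℝ)
    (hQ : ContDiffOn ℝ 3 Q (Set.Ioi 0))
    (hsub : ∀ r > (0 : ℝ), 0 ≤ deriv (deriv Q) r + deriv Q r / r)
    (hstrict : ∃ ε > (0 : ℝ), ∀ r ∈ Set.Ioo (R₀ - ε) (R₀ + ε),
        0 < deriv (deriv Q) r + deriv Q r / r)
    (hr₀ : r₀ = sInf {t : ℝ | 0 < t ∧ ∀ r > t, 0 < deriv Q r})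
    (hR₀ : R₀ * deriv Q R₀ = 2)
    (hR₀min : ∀ R > (0 : ℝ), R * deriv Q R = 2 → R₀ ≤ R)
    (hr₀pos : 0 < r₀) (hr₀R₀ : r₀ < R₀)
    (hδ : δ = (1 / 4) * (deriv (deriv Q) R₀ + deriv Q R₀ / R₀)) (hδpos : 0 < δ)
    (ξ : ℝ) (hξ : ξ ≤ 0) :
    Tendsto (fun n : ℕ => ∑ k ∈ Finset.range n, xnk Q r₀ R₀ δ n k ξ)
      atTop (nhds (-ξ)) := by
  have hRpos : 0 < R₀ := hr₀pos.trans hr₀R₀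
  have hlog2 : 0 < Real.log 2 := Real.log_pos one_lt_two
  have hlog4 : Real.log 4 = 2 * Real.log 2 := by
    rw [show (4 : ℝ) = 2 ^ 2 by norm_num, Real.log_pow]
    norm_num
  have hQ' : ∀ r > 0, HasDerivAt Q (deriv Q r) r := fun r hr =>
    ((hQ.contDiffAt (Ioi_mem_nhds hr)).differentiableAt (by norm_num)).hasDerivAt
  have hQ'' : ∀ r > 0, HasDerivAt (deriv Q) (deriv (deriv Q) r) r := fun r hr =>
    (((hQ.deriv_of_isOpen (m := 2) isOpen_Ioi (by norm_num)).contDiffAt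
      (Ioi_mem_nhds hr)).differentiableAt (by norm_num)).hasDerivAt
  have hρ : ∀ v : ℝ, HasDerivAt (fun v => R₀ * Real.exp (-v)) (-(R₀ * Real.exp (-v))) v :=
    fun v => by simpa using ((hasDerivAt_neg v).exp.const_mul R₀)
  have hρpos : ∀ v : ℝ, 0 < R₀ * Real.exp (-v) := fun v => mul_pos hRpos (Real.exp_pos _)
  set g : ℝ → ℝ := fun v => Q (R₀ * Real.exp (-v)) - Q R₀ + 2 * v with hg
  set g' : ℝ → ℝ := fun v => 2 - R₀ * Real.exp (-v) * deriv Q (R₀ * Real.exp (-v)) with hg'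
  set g'' : ℝ → ℝ := fun v => (R₀ * Real.exp (-v)) ^ 2 *
    (deriv (deriv Q) (R₀ * Real.exp (-v)) +
      deriv Q (R₀ * Real.exp (-v)) / (R₀ * Real.exp (-v))) with hg''
  have hgd : ∀ v, HasDerivAt g (g' v) v := fun v => by
    refine ((((hQ' _ (hρpos v)).comp v (hρ v)).sub_const (Q R₀)).add
      ((hasDerivAt_id v).const_mul 2)).congr_deriv ?_
    simp only [hg']
    ring
  have hgd' : ∀ v, HasDerivAt g' (g'' v) v := fun v => by
    refine (((hρ v).mul ((hQ'' _ (hρpos v)).comp v (hρ v))).const_sub 2).congr_deriv ?_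
    have := (hρpos v).ne'
    simp only [hg'', Function.comp]
    field_simp
    ring
  have hg0 : g 0 = 0 := by simp [hg]
  have hg'0 : g' 0 = 0 := by simp [hg', hR₀]
  have hβ : 0 < 2 * R₀ ^ 2 * δ := by positivity
  have hg''0 : g'' 0 = 2 * (2 * R₀ ^ 2 * δ) := by
    simp only [hg'', neg_zero, Real.exp_zero, mul_one, hδ]
    ring
  have hgc : Continuous g := continuous_iff_continuousAt.2 fun v => (hgd v).continuousAt
  have hlim := tendsto_div_sq_of_hasDerivAt hgd (hg''0 ▸ hgd' 0) hg0 hg'0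
  have hpos := pos_of_hasDerivAt_of_nonneg hβ hgd hgd'
    (fun v => mul_nonneg (sq_nonneg _) (hsub _ (hρpos v))) hg'0 hlim
  have hL : 0 < Real.log (R₀ / r₀) := Real.log_pos ((one_lt_div hr₀pos).2 hr₀R₀)
  obtain ⟨a, ha, A, hA, hbounds⟩ := exists_quadratic_bounds hgc hL hβ hg0 hpos hlim
  set τ : ℝ := ξ / (R₀ ^ 2 * δ * Real.log 4) with hτ
  have hlog4pos : 0 < Real.log 4 := by rw [hlog4]; positivity
  have hτ0 : τ ≤ 0 := div_nonpos_of_nonpos_of_nonneg hξ (by positivity)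
  have hxn : ∀ n : ℕ, 0 < n → xn R₀ δ n ξ = R₀ * (1 + τ / n) := fun n hn => by
    have : (n : ℝ) ≠ 0 := by exact_mod_cast hn.ne'
    simp only [xn, hτ]
    field_simp
  have hτlim : Tendsto (fun n : ℕ => 1 + τ / n) atTop (nhds 1) := by
    simpa using (tendsto_natCast_atTop_atTop.const_div_atTop τ).const_add 1
  have hτpos : ∀ᶠ n : ℕ in atTop, 0 < 1 + τ / n := hτlim.eventually_const_lt one_pos
  have hwlog : ∀ᶠ n : ℕ in atTop, Real.log (R₀ / xn R₀ δ n ξ) = -Real.log (1 + τ / n) := by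
    filter_upwards [eventually_gt_atTop 0] with n hn
    rw [hxn n hn, ← div_div, div_self hRpos.ne', one_div, Real.log_inv]
  have hmain := tendsto_sum_integral_exp_div (c := -τ) (w := fun n => Real.log (R₀ / xn R₀ δ n ξ))
    hgc hL ha hA hβ (fun v hv => (hbounds v hv).1) (fun v hv => (hbounds v hv).2) hlim ?_ ?_
  · have hval : -τ * (2 * R₀ ^ 2 * δ * Real.log 2) = -ξ := by
      rw [hτ, hlog4]
      field_simp
    rw [hval] at hmain
    refine hmain.congr' ?_
    filter_upwards [eventually_gt_atTop 0, hτpos] with n hn hn'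
    refine Finset.sum_congr rfl fun k _ => ?_
    rw [xnk, integral_exp_Vnk_eq hQ.continuousOn hRpos
      (by rw [hxn n hn]; exact mul_pos hRpos hn') hn k,
      integral_exp_Vnk_eq hQ.continuousOn hRpos hr₀pos hn k,
      mul_div_mul_left _ _ (Real.exp_pos _).ne']
  · filter_upwards [hwlog, hτpos] with n hn hn'
    rw [hn]
    have : τ / n ≤ 0 := div_nonpos_of_nonpos_of_nonneg hτ0 n.cast_nonneg
    exact neg_nonneg.2 (Real.log_nonpos hn'.le (by linarith))
  · refine ((Real.tendsto_mul_log_one_add_div_atTop τ).comp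
      tendsto_natCast_atTop_atTop).neg.congr' ?_
    filter_upwards [hwlog] with n hn
    simp only [Function.comp]
    rw [hn, mul_neg]
end

section
/- For every fixed ξ ≤ 0 there exists a constant C > 0 such that for all sufficiently large n and all integers 0 ≤ k ≤ n−1: x_{n,k}(ξ) ≤ C n^{−1/2}. In particular max_{0 ≤ k ≤ n−1} x_{n,k}(ξ) → 0 as n → ∞. -/
open MeasureTheory Filter Finset

/-- If `f` is positive and almost decreasing up to the factor `K` on `[b - h, b]`, then its mass
on a short terminal interval `[x, b]` is a small fraction of its mass on `[a, b]`. -/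
theorem integral_div_integral_le_of_almost_antitone {f : ℝ → ℝ} {a b x h K : ℝ}
    (hf : ContinuousOn f (Set.Icc a b)) (hpos : ∀ r, 0 < f r) (hh : 0 < h) (hK : 0 < K)
    (hah : a ≤ b - h) (hx : b - h / 2 ≤ x) (hxb : x ≤ b)
    (hanti : ∀ r s, b - h ≤ r → r ≤ s → s ≤ b → f s ≤ K * f r) :
    (∫ r in x..b, f r) / (∫ r in a..b, f r) ≤ 2 * K ^ 2 * (b - x) / h := by
  have hint : ∀ u v, a ≤ u → u ≤ v → v ≤ b → IntervalIntegrable f volume u v :=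
    fun u v hu huv hv => (hf.mono (by
      rw [Set.uIcc_of_le huv]; exact Set.Icc_subset_Icc hu hv)).intervalIntegrable
  have hnum : ∫ r in x..b, f r ≤ (b - x) * (K * f (b - h / 2)) := by
    have := intervalIntegral.integral_mono_on (g := fun _ => K * f (b - h / 2)) hxb
      (hint x b (by linarith) hxb le_rfl) intervalIntegrable_const
      (fun s hs => hanti _ s (by linarith) (hx.trans hs.1) hs.2)
    rwa [intervalIntegral.integral_const, smul_eq_mul] at this
  have hmid : (h / 2) * (f (b - h / 2) / K) ≤ ∫ r in (b - h)..(b - h / 2), f r := by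
    have := intervalIntegral.integral_mono_on (f := fun _ => f (b - h / 2) / K)
      (a := b - h) (b := b - h / 2) (by linarith) intervalIntegrable_const
      (hint _ _ hah (by linarith) (by linarith))
      (fun s hs => by
        rw [div_le_iff₀' hK]
        exact hanti s _ hs.1 hs.2 (by linarith))
    rw [intervalIntegral.integral_const, smul_eq_mul] at this
    convert this using 2
    ring
  have hden : (h / 2) * (f (b - h / 2) / K) ≤ ∫ r in a..b, f r :=
    hmid.trans (intervalIntegral.integral_mono_interval hah (by linarith) (by linarith)
      (Eventually.of_forall fun r => (hpos r).le) (hint a b (by linarith) (by linarith) le_rfl))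
  have hm := hpos (b - h / 2)
  have hden_pos : 0 < (h / 2) * (f (b - h / 2) / K) := by positivity
  rw [div_le_iff₀ (hden_pos.trans_le hden)]
  have hbx : 0 ≤ b - x := by linarith
  calc ∫ r in x..b, f r ≤ (b - x) * (K * f (b - h / 2)) := hnum
    _ = 2 * K ^ 2 * (b - x) / h * ((h / 2) * (f (b - h / 2) / K)) := by field_simp
    _ ≤ _ := by gcongr

/-- A function differentiable at a point grows at most linearly away from its value there. -/
theorem exists_abs_sub_le_of_differentiableAt {g : ℝ → ℝ} {b : ℝ} (hg : DifferentiableAt ℝ g b) :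
    ∃ M > (0 : ℝ), ∃ ε > (0 : ℝ), ∀ r, |r - b| < ε → |g r - g b| ≤ M * |r - b| := by
  obtain ⟨M, hM, hbound⟩ := hg.isBigO_sub.exists_pos
  obtain ⟨ε, hε, hball⟩ := Metric.eventually_nhds_iff.1 hbound.bound
  exact ⟨M, hM, ε, hε, fun r hr => hball hr⟩

theorem hasDerivAt_Vnk {Q : ℝ → ℝ} {n k : ℕ} {r : ℝ} (hQ : DifferentiableAt ℝ Q r) (hr : r ≠ 0) :
    HasDerivAt (Vnk Q n k) ((r * deriv Q r - (2 - (2 * (k : ℝ) + 1) / n)) / r) r := by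
  refine (hQ.hasDerivAt.sub ((Real.hasDerivAt_log hr).const_mul _)).congr_deriv ?_
  rw [sub_div, mul_div_cancel_left₀ _ hr, div_eq_mul_inv (2 - _)]

/-- On the scale `n^{-1/2}` below `b`, the weight `e^{-nV}` is almost decreasing, because the outer
radius `b` lies to the right of the minimum of every `V_{n,k}`. -/
theorem exp_neg_Vnk_le {Q : ℝ → ℝ} {a b h M : ℝ} {n k : ℕ} (ha : 0 < a)
    (hQ : ∀ r, 0 < r → DifferentiableAt ℝ Q r) (hah : a ≤ b - h) (hM : 0 < M) (hh : 0 < h)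
    (hnh : n * h ^ 2 = 1)
    (hbound : ∀ r, b - h ≤ r → r ≤ b → |r * deriv Q r - 2| ≤ M * |r - b|)
    {r s : ℝ} (hr : b - h ≤ r) (hrs : r ≤ s) (hs : s ≤ b) :
    Real.exp (-(n : ℝ) * Vnk Q n k s) ≤ Real.exp (M / a) * Real.exp (-(n : ℝ) * Vnk Q n k r) := by
  rw [← Real.exp_add, Real.exp_le_exp]
  have hderiv : ∀ c, a ≤ c → HasDerivAt (Vnk Q n k) _ c := fun c hc =>
    hasDerivAt_Vnk (hQ c (ha.trans_le hc)) (ha.trans_le hc).ne'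
  have hslope : -(M * h / a) * (s - r) ≤ Vnk Q n k s - Vnk Q n k r := by
    refine (convex_Icc (b - h) b).mul_sub_le_image_sub_of_le_deriv
      (fun c hc => (hderiv c (hah.trans hc.1)).continuousAt.continuousWithinAt) ?_ ?_
      r ⟨hr, hrs.trans hs⟩ s ⟨hr.trans hrs, hs⟩ hrs
    · exact fun c hc => (hderiv c (hah.trans (interior_subset hc).1)
        ).differentiableAt.differentiableWithinAt
    · intro c hc
      obtain ⟨hc1, hc2⟩ := interior_subset hc
      have hac : a ≤ c := hah.trans hc1
      have hc0 : 0 < c := ha.trans_le hac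
      rw [(hderiv c hac).deriv, le_div_iff₀ hc0]
      have h1 := (abs_le.1 (hbound c hc1 hc2)).1
      have h2 : |c - b| ≤ h := by rw [abs_le]; constructor <;> linarith
      have h3 : M * |c - b| ≤ M * h := by gcongr
      have h4 : (0 : ℝ) ≤ (2 * (k : ℝ) + 1) / n := by positivity
      have h5 : M * h ≤ M * h / a * c := by
        rw [div_mul_eq_mul_div, le_div_iff₀ ha]; gcongr
      linarith
  have hsr : M * h / a * (s - r) ≤ M * h / a * h := by
    gcongr; linarith
  have hkey : (n : ℝ) * -(M * h / a * h) ≤ n * (Vnk Q n k s - Vnk Q n k r) := by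
    gcongr; linarith
  have hscale : (n : ℝ) * -(M * h / a * h) = -(M / a) := by
    linear_combination -(M / a) * hnh
  linarith

theorem xnk_nonneg {Q : ℝ → ℝ} {r₀ R₀ δ : ℝ} {n k : ℕ} {ξ : ℝ} (hr : r₀ ≤ R₀)
    (hx : xn R₀ δ n ξ ≤ R₀) : 0 ≤ xnk Q r₀ R₀ δ n k ξ :=
  div_nonneg (intervalIntegral.integral_nonneg hx fun _ _ => (Real.exp_pos _).le)
    (intervalIntegral.integral_nonneg hr fun _ _ => (Real.exp_pos _).le)

/-- Uniform bound `x_{n,k}(ξ) ≤ C n^{−1/2}`; in particular `max_{k<n} x_{n,k}(ξ) → 0`. -/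
theorem hard_edge_radial_uniform_bound
    (Q : ℝ → ℝ) (r₀ R₀ δ : ℝ)
    (hQ : ContDiffOn ℝ 3 Q (Set.Ioi 0))
    (hsub : ∀ r > (0 : ℝ), 0 ≤ deriv (deriv Q) r + deriv Q r / r)
    (hstrict : ∃ ε > (0 : ℝ), ∀ r ∈ Set.Ioo (R₀ - ε) (R₀ + ε),
        0 < deriv (deriv Q) r + deriv Q r / r)
    (hr₀ : r₀ = sInf {t : ℝ | 0 < t ∧ ∀ r > t, 0 < deriv Q r})
    (hR₀ : R₀ * deriv Q R₀ = 2)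
    (hR₀min : ∀ R > (0 : ℝ), R * deriv Q R = 2 → R₀ ≤ R)
    (hr₀pos : 0 < r₀) (hr₀R₀ : r₀ < R₀)
    (hδ : δ = (1 / 4) * (deriv (deriv Q) R₀ + deriv Q R₀ / R₀)) (hδpos : 0 < δ)
    (ξ : ℝ) (hξ : ξ ≤ 0) :
    (∃ C > (0 : ℝ), ∃ N : ℕ, ∀ n ≥ N, ∀ k < n,
        xnk Q r₀ R₀ δ n k ξ ≤ C / Real.sqrt n) ∧
      Tendsto (fun n : ℕ => ⨆ k ∈ Finset.range n, xnk Q r₀ R₀ δ n k ξ)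
        atTop (nhds 0) := by
  have hR₀pos : 0 < R₀ := hr₀pos.trans hr₀R₀
  have hdiff : ∀ r, 0 < r → DifferentiableAt ℝ Q r := fun r hr =>
    (hQ.contDiffAt (Ioi_mem_nhds hr)).differentiableAt (by norm_num)
  have hdiff' : DifferentiableAt ℝ (fun r => r * deriv Q r) R₀ :=
    differentiableAt_id.mul
      (((hQ.deriv_of_isOpen (m := 1) isOpen_Ioi (by norm_num)).contDiffAt
      (Ioi_mem_nhds hR₀pos)).differentiableAt one_ne_zero)
  obtain ⟨M, hM, ε, hε, hbound⟩ := exists_abs_sub_le_of_differentiableAt hdiff'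
  simp only [hR₀] at hbound
  have hD : 0 < R₀ * δ * Real.log 4 := mul_pos (mul_pos hR₀pos hδpos) (Real.log_pos (by norm_num))
  set L : ℝ := -ξ / (R₀ * δ * Real.log 4) with hL
  have hL0 : 0 ≤ L := div_nonneg (by linarith) hD.le
  have hxn : ∀ n : ℕ, xn R₀ δ n ξ = R₀ - L / n := fun n => by
    rw [xn, hL, div_div, mul_comm _ (n : ℝ), neg_div, sub_neg_eq_add, mul_assoc, mul_assoc,
      mul_assoc]
  have hxn_le : ∀ n : ℕ, xn R₀ δ n ξ ≤ R₀ := fun n => by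
    rw [hxn]; exact sub_le_self _ (by positivity)
  set K : ℝ := Real.exp (M / r₀) with hK
  have hlim : Tendsto (fun n : ℕ => 1 / Real.sqrt n) atTop (nhds 0) := by
    simp only [one_div]
    exact (Real.tendsto_sqrt_atTop.comp tendsto_natCast_atTop_atTop).inv_tendsto_atTop
  have hsmall : ∀ c > (0 : ℝ), ∀ᶠ n : ℕ in atTop, 1 / Real.sqrt n < c := fun c hc =>
    hlim.eventually_lt_const hc
  have hev : ∀ᶠ n : ℕ in atTop, ∀ k < n,
      xnk Q r₀ R₀ δ n k ξ ≤ (2 * K ^ 2 * L + 1) / Real.sqrt n := by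
    filter_upwards [hsmall ε hε, hsmall (R₀ - r₀) (sub_pos.2 hr₀R₀),
      hsmall (1 / (2 * (L + 1))) (by positivity), eventually_gt_atTop 0] with n h1 h2 h3 hn k _
    have hn0 : (0 : ℝ) < n := by exact_mod_cast hn
    have hsqrt : 0 < Real.sqrt n := Real.sqrt_pos.2 hn0
    set h : ℝ := 1 / Real.sqrt n with hh
    have hh0 : 0 < h := by positivity
    have hnh : (n : ℝ) * h ^ 2 = 1 := by
      rw [hh, div_pow, Real.sq_sqrt hn0.le]; field_simp
    have hLn : L / n = L * h ^ 2 := by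
      rw [div_eq_iff hn0.ne']; linear_combination -L * hnh
    have hLh : L * h ≤ 1 / 2 := by
      rw [lt_div_iff₀ (by positivity)] at h3
      nlinarith
    have hratio := integral_div_integral_le_of_almost_antitone
      (f := fun r => Real.exp (-(n : ℝ) * Vnk Q n k r)) (a := r₀) (b := R₀) (x := xn R₀ δ n ξ)
      (h := h) (K := K)
      (fun r hr => by
        have hr0 : 0 < r := hr₀pos.trans_le hr.1
        exact ((hasDerivAt_Vnk (hdiff r hr0) hr0.ne').continuousAt.const_mul
          _).rexp.continuousWithinAt)
      (fun r => Real.exp_pos _) hh0 (Real.exp_pos _) (by linarith)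
      (by rw [hxn, hLn]; nlinarith) (hxn_le n)
      (fun r s hr hrs hs => exp_neg_Vnk_le hr₀pos hdiff (by linarith) hM hh0 hnh
        (fun c hc1 hc2 => hbound c (by rw [abs_lt]; constructor <;> linarith)) hr hrs hs)
    calc xnk Q r₀ R₀ δ n k ξ ≤ 2 * K ^ 2 * (R₀ - xn R₀ δ n ξ) / h := hratio
      _ = 2 * K ^ 2 * L * h := by rw [hxn, hLn]; field_simp; ring
      _ ≤ (2 * K ^ 2 * L + 1) * h := by gcongr; linarith
      _ = _ := by rw [hh, mul_one_div]
  have hC : 0 < 2 * K ^ 2 * L + 1 := by positivity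
  refine ⟨⟨_, hC, eventually_atTop.1 hev⟩, ?_⟩
  have hlimC : Tendsto (fun n : ℕ => (2 * K ^ 2 * L + 1) / Real.sqrt n) atTop (nhds 0) := by
    simpa [div_eq_mul_inv] using hlim.const_mul (2 * K ^ 2 * L + 1)
  refine tendsto_of_tendsto_of_tendsto_of_le_of_le' tendsto_const_nhds hlimC
    (Eventually.of_forall fun n => Real.iSup_nonneg fun k => Real.iSup_nonneg fun _ =>
      xnk_nonneg hr₀R₀.le (hxn_le n)) ?_
  filter_upwards [hev] with n hn
  have h0 : 0 ≤ (2 * K ^ 2 * L + 1) / Real.sqrt n := by positivity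
  exact Real.iSup_le (fun k => Real.iSup_le (fun hk => hn k (Finset.mem_range.1 hk)) h0) h0
end

section
/- Let 0 < a < R₀ and let f : [a, R₀] → ℝ be nondecreasing, twice continuously differentiable on a neighborhood of R₀ in [a, R₀], with f(a) ≤ 0, f(R₀) = 2 and β := f'(R₀) > 0, and assume f is strictly increasing on a neighborhood of R₀. Then there exist C > 0 and N such that for all n ≥ N and all integers 0 ≤ k ≤ √n log n: there is a unique t_{n,k} ∈ [a, R₀] with f(t_{n,k}) = 2 − (2k+1)/n, and | (R₀ − t_{n,k}) − (2k+1)/(β n) | ≤ C (log n)² / n. -/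
open Filter

/-- One-sided quadratic Taylor estimate at the right endpoint of an interval. -/
theorem exists_abs_sub_linear_le_sq {f : ℝ → ℝ} {x₀ β ε : ℝ} (hε : 0 < ε)
    (hf : ContDiffOn ℝ 2 f (Set.Icc (x₀ - ε) x₀)) (hd : HasDerivAt f β x₀) :
    ∃ K > (0 : ℝ), ∀ s ∈ Set.Icc 0 ε, |f (x₀ - s) - f x₀ + β * s| ≤ K * s ^ 2 := by
  have hg : ContDiffOn ℝ (1 + 1 : ℕ) (fun s => f (x₀ - s)) (Set.Icc 0 ε) := by
    refine ContDiffOn.comp (by exact_mod_cast hf) (by fun_prop) fun s hs => ?_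
    constructor <;> linarith [hs.1, hs.2]
  obtain ⟨K, hK⟩ := exists_taylor_mean_remainder_bound (n := 1) hε.le (by exact_mod_cast hg)
  refine ⟨max K 1, by positivity, fun s hs => ?_⟩
  have hder : derivWithin (fun s => f (x₀ - s)) (Set.Icc 0 ε) 0 = -β := by
    have h₀ : HasDerivAt f β (x₀ - 0) := by simpa using hd
    have h₁ : HasDerivAt (fun s => f (x₀ - s)) (-β) 0 := h₀.comp_const_sub x₀ 0
    exact h₁.hasDerivWithinAt.derivWithin (uniqueDiffOn_Icc hε 0 ⟨le_rfl, hε.le⟩)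
  have h := hK s hs
  rw [taylorWithinEval_succ, taylor_within_zero_eval, iteratedDerivWithin_one, hder,
    Real.norm_eq_abs] at h
  norm_num at h
  calc |f (x₀ - s) - f x₀ + β * s| = |f (x₀ - s) - (f x₀ + -(s * β))| := by congr 1; ring
    _ ≤ K * s ^ 2 := h
    _ ≤ max K 1 * s ^ 2 := by gcongr; exact le_max_left _ _

/-- Inverting `h ≈ β s` with a quadratic error, for `s` small enough to absorb the error. -/
theorem abs_sub_div_le_of_abs_sub_mul_le {β K s h : ℝ} (hβ : 0 < β) (hK : 0 < K) (hs : 0 ≤ s)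
    (hsmall : K * s ≤ β / 2) (hq : |β * s - h| ≤ K * s ^ 2) :
    |s - h / β| ≤ 4 * K / β ^ 3 * h ^ 2 := by
  have hle : β * s ≤ 2 * h := by
    nlinarith [(abs_le.mp hq).2, mul_le_mul_of_nonneg_right hsmall hs]
  have hsq : (β * s) ^ 2 ≤ (2 * h) ^ 2 := by gcongr
  have heq : s - h / β = (β * s - h) / β := by field_simp
  rw [heq, abs_div, abs_of_pos hβ, div_le_iff₀ hβ]
  refine hq.trans ?_
  have : 4 * K / β ^ 3 * h ^ 2 * β = K * (2 * h) ^ 2 / β ^ 2 := by field_simp; ring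
  rw [this, le_div_iff₀ (by positivity)]
  nlinarith

theorem eventually_log_le_mul_sqrt {c : ℝ} (hc : 0 < c) :
    ∀ᶠ n : ℕ in atTop, Real.log n ≤ c * Real.sqrt n := by
  have h := ((isLittleO_log_rpow_atTop (r := 1 / 2) (by norm_num)).bound hc)
  filter_upwards [tendsto_natCast_atTop_atTop.eventually h] with n hn
  rw [← Real.sqrt_eq_rpow, Real.norm_eq_abs, Real.norm_eq_abs,
    abs_of_nonneg (Real.sqrt_nonneg _)] at hn
  exact (le_abs_self _).trans hn

/-- Location of the critical point: if `f` is nondecreasing on `[a, R₀]`, `C²` near `R₀`,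
strictly increasing near `R₀`, with `f(a) ≤ 0`, `f(R₀) = 2` and `β = f'(R₀) > 0`, then for
large `n` and `0 ≤ k ≤ √n log n` there is a unique `t_{n,k} ∈ [a, R₀]` with
`f(t_{n,k}) = 2 − (2k+1)/n`, and `|(R₀ − t_{n,k}) − (2k+1)/(β n)| ≤ C (log n)²/n`. -/
theorem critical_point_location
    (a R₀ β : ℝ) (f : ℝ → ℝ) (ha : 0 < a) (haR : a < R₀)
    (hmono : MonotoneOn f (Set.Icc a R₀))
    (hC2 : ∃ ε > (0 : ℝ), ContDiffOn ℝ 2 f (Set.Icc (R₀ - ε) R₀))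
    (hfa : f a ≤ 0) (hfR : f R₀ = 2)
    (hβ : β = deriv f R₀) (hβpos : 0 < β)
    (hstrict : ∃ ε > (0 : ℝ), StrictMonoOn f (Set.Icc (R₀ - ε) R₀)) :
    ∃ C > (0 : ℝ), ∃ N : ℕ, ∀ n ≥ N, ∀ k : ℕ,
      (k : ℝ) ≤ Real.sqrt n * Real.log n →
      (∃! t, t ∈ Set.Icc a R₀ ∧ f t = 2 - (2 * (k : ℝ) + 1) / n) ∧
      ∀ t ∈ Set.Icc a R₀, f t = 2 - (2 * (k : ℝ) + 1) / n →
        |(R₀ - t) - (2 * (k : ℝ) + 1) / (β * n)| ≤ C * (Real.log n) ^ 2 / n := by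
  have hd : HasDerivAt f β R₀ := by
    rw [hβ]
    exact (differentiableAt_of_deriv_ne_zero (hβ ▸ hβpos).ne').hasDerivAt
  obtain ⟨ε₁, hε₁, hC2⟩ := hC2
  obtain ⟨ε₂, hε₂, hstrict⟩ := hstrict
  obtain ⟨K, hK, hquad⟩ := exists_abs_sub_linear_le_sq hε₁ hC2 hd
  obtain ⟨δ, hδ, hδ₁, hδ₂, hδa, hδK⟩ :
      ∃ δ > (0 : ℝ), δ ≤ ε₁ ∧ δ ≤ ε₂ ∧ δ ≤ R₀ - a ∧ δ ≤ β / 2 / K := by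
    refine ⟨min (min ε₁ ε₂) (min (R₀ - a) (β / 2 / K)), ?_, ?_, ?_, ?_, ?_⟩
    · have := sub_pos.mpr haR
      positivity
    all_goals simp
  rw [le_div_iff₀ hK] at hδK
  have hcont : ContinuousOn f (Set.Icc (R₀ - δ) R₀) :=
    hC2.continuousOn.mono (Set.Icc_subset_Icc_left (by linarith))
  have hinj : StrictMonoOn f (Set.Icc (R₀ - δ) R₀) :=
    hstrict.mono (Set.Icc_subset_Icc_left (by linarith))
  have hgap : f (R₀ - δ) < 2 := hfR ▸ hinj ⟨le_rfl, by linarith⟩ ⟨by linarith, le_rfl⟩ (by linarith)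
  have hη : 0 < (2 - f (R₀ - δ)) / 4 := by linarith
  obtain ⟨N, hN⟩ := eventually_atTop.mp (eventually_log_le_mul_sqrt hη)
  refine ⟨36 * K / β ^ 3, by positivity, max N 3, fun n hn k hk => ?_⟩
  have hn3 : (3 : ℝ) ≤ n := by exact_mod_cast (le_max_right N 3).trans hn
  have hnpos : (0 : ℝ) < n := by linarith
  have hlog : Real.log n ≤ (2 - f (R₀ - δ)) / 4 * Real.sqrt n := hN n ((le_max_left N 3).trans hn)
  have hlog1 : 1 ≤ Real.log n := by
    rw [Real.le_log_iff_exp_le hnpos]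
    linarith [Real.exp_one_lt_d9]
  have hsq : Real.sqrt n * Real.sqrt n = n := Real.mul_self_sqrt hnpos.le
  have hsqrt1 : 1 ≤ Real.sqrt n := Real.one_le_sqrt.mpr (by linarith)
  have hnum : 2 * (k : ℝ) + 1 ≤ 3 * (Real.sqrt n * Real.log n) := by nlinarith
  set h : ℝ := (2 * (k : ℝ) + 1) / n with hh
  have hpos : 0 < h := by positivity
  have hlt : h < 2 - f (R₀ - δ) := by
    rw [hh, div_lt_iff₀ hnpos]
    have := mul_le_mul_of_nonneg_left hlog (Real.sqrt_nonneg n)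
    nlinarith
  have hhsq : h ^ 2 ≤ 9 * Real.log n ^ 2 / n := by
    rw [hh, div_pow, div_le_div_iff₀ (by positivity) hnpos]
    have : (2 * (k : ℝ) + 1) ^ 2 ≤ (3 * (Real.sqrt n * Real.log n)) ^ 2 := by gcongr
    have heq : (3 * (Real.sqrt n * Real.log n)) ^ 2 = 9 * Real.log n ^ 2 * n := by
      linear_combination 9 * Real.log n ^ 2 * hsq
    rw [heq] at this
    nlinarith
  have hloc : ∀ t ∈ Set.Icc a R₀, f t = 2 - h → t ∈ Set.Icc (R₀ - δ) R₀ := by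
    refine fun t ht hft => ⟨?_, ht.2⟩
    by_contra! hlt'
    have := hmono ht ⟨by linarith, by linarith⟩ hlt'.le
    linarith
  refine ⟨?_, fun t ht hft => ?_⟩
  · obtain ⟨t, ht, hft⟩ := intermediate_value_Icc (by linarith) hcont
      (show 2 - h ∈ Set.Icc (f (R₀ - δ)) (f R₀) from ⟨by linarith, by linarith⟩)
    refine ⟨t, ⟨⟨by linarith [ht.1], ht.2⟩, hft⟩, fun u hu => ?_⟩
    exact hinj.injOn (hloc u hu.1 hu.2) ht (hu.2.trans hft.symm)
  · have htloc := hloc t ht hft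
    have hs : 0 ≤ R₀ - t := by linarith [ht.2]
    have hsδ : R₀ - t ≤ δ := by linarith [htloc.1]
    have hq := hquad (R₀ - t) ⟨hs, hsδ.trans hδ₁⟩
    rw [sub_sub_cancel, hft, hfR] at hq
    have hmain := abs_sub_div_le_of_abs_sub_mul_le (h := h) hβpos hK hs
      (by nlinarith) (by convert hq using 2; ring)
    have hdiv : (2 * (k : ℝ) + 1) / (β * n) = h / β := by rw [hh, div_div, mul_comm β]
    rw [hdiv]
    calc |R₀ - t - h / β| ≤ 4 * K / β ^ 3 * h ^ 2 := hmain
      _ ≤ 4 * K / β ^ 3 * (9 * Real.log n ^ 2 / n) := by gcongr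
      _ = 36 * K / β ^ 3 * Real.log n ^ 2 / n := by ring
end

section
/- Suppose that for each n ∈ ℕ real numbers x_{n,0}, …, x_{n,n−1} ∈ [0,1) are given such that Σ_{j=0}^{n−1} x_{n,j} → S ∈ ℝ and max_{0 ≤ j ≤ n−1} x_{n,j} → 0 as n → ∞. Define the polynomials g_n : ℂ → ℂ by g_n(λ) = ∏_{j=0}^{n−1} (1 + λ x_{n,j}). Then g_n(λ) → e^{λ S} uniformly on every compact subset of ℂ, and for every k ∈ ℕ the k-th complex derivative satisfies g_n^{(k)}(−1) → S^k e^{−S} as n → ∞. -/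
open Filter Finset

/-- Locally uniform convergence of entire functions passes to all iterated derivatives. -/
theorem TendstoLocallyUniformlyOn.iteratedDeriv_univ {ι : Type*} {φ : Filter ι}
    {F : ι → ℂ → ℂ} {f : ℂ → ℂ} (hf : TendstoLocallyUniformlyOn F f φ Set.univ)
    (hF : ∀ n, Differentiable ℂ (F n)) (k : ℕ) :
    TendstoLocallyUniformlyOn (fun n => iteratedDeriv k (F n)) (iteratedDeriv k f) φ
      Set.univ := by
  induction k with
  | zero => simpa using hf
  | succ k ih =>
    simp only [iteratedDeriv_succ]
    refine ih.deriv (Eventually.of_forall fun n => ?_) isOpen_univ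
    exact ((hF n).contDiff.differentiable_iteratedDeriv k (WithTop.coe_lt_top _)).differentiableOn

/-- The error of the linear approximation of `∑ log (1 + z * x j)` for small `x j ≥ 0`. -/
theorem norm_sum_log_one_add_mul_sub_le {ι : Type*} (s : Finset ι) (x : ι → ℝ) {z : ℂ} {R δ : ℝ}
    (hz : ‖z‖ ≤ R) (hR : R * δ ≤ 1 / 2) (h0 : ∀ j ∈ s, 0 ≤ x j) (hδ : ∀ j ∈ s, x j ≤ δ) :
    ‖∑ j ∈ s, Complex.log (1 + z * (x j : ℂ)) - z * ((∑ j ∈ s, x j : ℝ) : ℂ)‖ ≤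
      R ^ 2 * δ * ∑ j ∈ s, x j := by
  push_cast
  rw [Finset.mul_sum, Finset.mul_sum, ← Finset.sum_sub_distrib]
  refine norm_sum_le_of_le s fun j hj => ?_
  have hxj := h0 j hj
  have hR0 : 0 ≤ R := (norm_nonneg z).trans hz
  have hn : ‖z * (x j : ℂ)‖ = ‖z‖ * x j := by
    rw [norm_mul, Complex.norm_real, Real.norm_of_nonneg hxj]
  have hle : ‖z * (x j : ℂ)‖ ≤ R * x j := by rw [hn]; gcongr
  have hhalf : ‖z * (x j : ℂ)‖ ≤ 1 / 2 := by
    refine (hle.trans ?_).trans hR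
    gcongr
    exact hδ j hj
  have hinv : (1 - ‖z * (x j : ℂ)‖)⁻¹ ≤ 2 := by
    rw [inv_le_comm₀ (by linarith) two_pos]
    linarith
  calc ‖Complex.log (1 + z * (x j : ℂ)) - z * (x j : ℂ)‖
      ≤ ‖z * (x j : ℂ)‖ ^ 2 * (1 - ‖z * (x j : ℂ)‖)⁻¹ / 2 :=
        Complex.norm_log_one_add_sub_self_le (by linarith)
    _ ≤ ‖z * (x j : ℂ)‖ ^ 2 * 2 / 2 := by gcongr
    _ ≤ (R * x j) ^ 2 := by rw [mul_div_cancel_right₀ _ two_ne_zero]; gcongr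
    _ = R ^ 2 * x j * x j := by ring
    _ ≤ R ^ 2 * δ * x j := by gcongr; exact hδ j hj

/-- If `x_{n,j} ∈ [0,1)`, `Σ_{j<n} x_{n,j} → S` and `max_{j<n} x_{n,j} → 0`, then the
polynomials `g_n(z) = ∏_{j<n} (1 + z x_{n,j})` converge to `e^{zS}` locally uniformly on `ℂ`,
and `g_n^{(k)}(−1) → S^k e^{−S}` for every `k`. -/
theorem product_polynomials_converge_to_exponential
    (x : ℕ → ℕ → ℝ) (S : ℝ)
    (hx : ∀ n : ℕ, ∀ j < n, 0 ≤ x n j ∧ x n j < 1)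
    (hsum : Tendsto (fun n : ℕ => ∑ j ∈ Finset.range n, x n j) atTop (nhds S))
    (hmax : ∀ ε > (0 : ℝ), ∃ N : ℕ, ∀ n ≥ N, ∀ j < n, x n j < ε) :
    (∀ K : Set ℂ, IsCompact K →
      TendstoUniformlyOn
        (fun (n : ℕ) (z : ℂ) => ∏ j ∈ Finset.range n, (1 + z * (x n j : ℂ)))
        (fun z => Complex.exp (z * S)) atTop K) ∧
    ∀ k : ℕ,
      Tendsto
        (fun n : ℕ =>
          iteratedDeriv k (fun z : ℂ => ∏ j ∈ Finset.range n, (1 + z * (x n j : ℂ))) (-1))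
        atTop (nhds ((S : ℂ) ^ k * Complex.exp (-(S : ℂ)))) := by
  have hK : ∀ K : Set ℂ, IsCompact K →
      TendstoUniformlyOn
        (fun (n : ℕ) (z : ℂ) => ∏ j ∈ Finset.range n, (1 + z * (x n j : ℂ)))
        (fun z => Complex.exp (z * S)) atTop K := by
    intro K hK
    obtain ⟨R, hR0, hR⟩ := hK.isBounded.exists_pos_norm_le
    have hlog : TendstoUniformlyOn
        (fun (n : ℕ) (z : ℂ) => ∑ j ∈ Finset.range n, Complex.log (1 + z * (x n j : ℂ)))
        (fun z => z * S) atTop K := by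
      rw [Metric.tendstoUniformlyOn_iff]
      intro ε hε
      set C : ℝ := R ^ 2 * (|S| + 1) + R with hC
      have hC0 : 0 < C := by positivity
      obtain ⟨δ, hδ0, hδ⟩ : ∃ δ > 0, δ < min (1 / (2 * R)) (min 1 (ε / C)) :=
        exists_between (by positivity)
      simp only [lt_min_iff] at hδ
      obtain ⟨hδR, hδ1, hδC⟩ := hδ
      rw [lt_div_iff₀ (by positivity)] at hδR hδC
      obtain ⟨N, hN⟩ := hmax δ hδ0
      filter_upwards [eventually_ge_atTop N, Metric.tendsto_nhds.mp hsum δ hδ0]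
        with n hn hdist z hz
      rw [Real.dist_eq] at hdist
      have hs : ∑ j ∈ Finset.range n, x n j ≤ |S| + 1 := by
        have := (abs_lt.mp hdist).2
        have := le_abs_self S
        linarith
      have h1 := norm_sum_log_one_add_mul_sub_le (Finset.range n) (x n) (δ := δ) (hR z hz)
        (by linarith) (fun j hj => (hx n j (Finset.mem_range.mp hj)).1)
        (fun j hj => (hN n hn j (Finset.mem_range.mp hj)).le)
      have h2 : ‖z * ((∑ j ∈ Finset.range n, x n j : ℝ) : ℂ) - z * S‖ ≤ R * δ := by
        rw [← mul_sub, norm_mul, ← Complex.ofReal_sub, Complex.norm_real]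
        exact mul_le_mul (hR z hz) hdist.le (norm_nonneg _) hR0.le
      rw [dist_comm, dist_eq_norm]
      calc _ ≤ _ := norm_sub_le_norm_sub_add_norm_sub _
            (z * ((∑ j ∈ Finset.range n, x n j : ℝ) : ℂ)) _
        _ ≤ R ^ 2 * δ * (|S| + 1) + R * δ :=
            add_le_add (h1.trans (by gcongr)) h2
        _ = δ * C := by rw [hC]; ring
        _ < ε := hδC
    have hbdd : BddAbove ((fun z : ℂ => (z * (S : ℂ)).re) '' K) :=
      (hK.image (by fun_prop)).bddAbove
    refine (hlog.comp_cexp hbdd).congr ?_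
    obtain ⟨N, hN⟩ := hmax (1 / R) (by positivity)
    filter_upwards [eventually_ge_atTop N] with n hn z hz
    simp only [Function.comp_apply, Complex.exp_sum]
    refine Finset.prod_congr rfl fun j hj => Complex.exp_log fun h => ?_
    have hj := Finset.mem_range.mp hj
    have hlt := hN n hn j hj
    rw [lt_div_iff₀ hR0] at hlt
    have hnorm : ‖z‖ * x n j = 1 := by
      have := congrArg norm (eq_neg_of_add_eq_zero_right h)
      rwa [norm_mul, Complex.norm_real, Real.norm_of_nonneg (hx n j hj).1, norm_neg,
        norm_one] at this
    have := mul_le_mul_of_nonneg_right (hR z hz) (hx n j hj).1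
    linarith
  refine ⟨hK, fun k => ?_⟩
  have hloc : TendstoLocallyUniformlyOn
      (fun (n : ℕ) (z : ℂ) => ∏ j ∈ Finset.range n, (1 + z * (x n j : ℂ)))
      (fun z => Complex.exp (z * S)) atTop Set.univ :=
    (tendstoLocallyUniformlyOn_iff_forall_isCompact isOpen_univ).mpr fun K _ => hK K
  have h := (hloc.iteratedDeriv_univ (fun n => by fun_prop) k).tendsto_at (Set.mem_univ (-1))
  have hexp : iteratedDeriv k (fun z : ℂ => Complex.exp (z * S)) (-1) =
      (S : ℂ) ^ k * Complex.exp (-(S : ℂ)) := by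
    simp_rw [mul_comm _ (S : ℂ)]
    simp [iteratedDeriv_cexp_const_mul]
  rwa [hexp] at h
end
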